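/- arXiv:math/0210040 — 5 statements merged into one kernel-verified Lean document; each statement's English description precedes it below -/
import Mathlib

section
/- Let κ be a positive integer and p a nonnegative integer. Suppose u : ℂ×ℍ → ℂ is holomorphic in each variable and satisfies the KZB heat equation with parameters κ, p at every (λ,τ) ∈ ℂ×ℍ with ϑ₁(λ,τ) ≠ 0. Then the function Su(λ,τ) = e^{−πiκλ²/(2τ)} τ^{−1/2 − p(p+1)/κ} u(λ/τ, −1/τ), where the complex power τ^w is taken with arg τ ∈ (0,π) (principal branch on ℍ), also satisfies the KZB heat equation with parameters κ, p at every (λ,τ) ∈ ℂ×ℍ with ϑ₁(λ,τ) ≠ 0. -/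
open Complex

/-- The complex number π. -/
noncomputable def cπ : ℂ := Real.pi

/-- The first Jacobi theta function
`ϑ₁(λ,τ) = 2 q^{1/8} sin(πλ) ∏_{j≥1} (1-q^j e^{2πiλ})(1-q^j e^{-2πiλ})(1-q^j)`, `q = e^{2πiτ}`. -/
noncomputable def JTheta1 (z τ : ℂ) : ℂ :=
  2 * exp (cπ * I * τ / 4) * sin (cπ * z) *
    ∏' n : ℕ, ((1 - exp (2 * cπ * I * τ) ^ (n + 1) * exp (2 * cπ * I * z)) *
      (1 - exp (2 * cπ * I * τ) ^ (n + 1) * exp (-(2 * cπ * I * z))) *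
      (1 - exp (2 * cπ * I * τ) ^ (n + 1)))

/-- The Dedekind eta function `η(τ) = q^{1/24} ∏_{j≥1} (1-q^j)`, `q = e^{2πiτ}`. -/
noncomputable def DEta (τ : ℂ) : ℂ :=
  exp (cπ * I * τ / 12) * ∏' n : ℕ, (1 - exp (2 * cπ * I * τ) ^ (n + 1))

/-- The theta function of level κ:
`θ_{κ,n}(λ,τ) = Σ_{j∈ℤ} exp(2πiκ(j+n/(2κ))²τ + 2πiκ(j+n/(2κ))λ)`. -/
noncomputable def ThetaKN (κ : ℕ) (n : ℤ) (z τ : ℂ) : ℂ :=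
  ∑' j : ℤ, exp (2 * cπ * I * (κ : ℂ) * ((j : ℂ) + (n : ℂ) / (2 * (κ : ℂ))) ^ 2 * τ +
    2 * cπ * I * (κ : ℂ) * ((j : ℂ) + (n : ℂ) / (2 * (κ : ℂ))) * z)

/-- The symmetrization `θ^s_{κ,n}(λ,τ) = θ_{κ,n}(λ,τ) + θ_{κ,n}(-λ,τ)`. -/
noncomputable def ThetaS (κ : ℕ) (n : ℤ) (z τ : ℂ) : ℂ :=
  ThetaKN κ n z τ + ThetaKN κ n (-z) τ

/-- `ρ(λ,τ) = ϑ₁'(λ,τ)/ϑ₁(λ,τ)` (derivative in the first argument). -/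
noncomputable def Rho (z τ : ℂ) : ℂ :=
  deriv (fun w => JTheta1 w τ) z / JTheta1 z τ

/-- `ρ'(λ,τ)`, the derivative of `ρ` in the first argument. -/
noncomputable def Rho' (z τ : ℂ) : ℂ := deriv (fun w => Rho w τ) z

/-- `u` satisfies the KZB heat equation with parameters `κ`, `p` at `(λ,τ)`:
`2πiκ ∂u/∂τ = ∂²u/∂λ² + p(p+1)ρ'(λ,τ)u`. -/
def KZB (κ p : ℕ) (u : ℂ → ℂ → ℂ) (z τ : ℂ) : Prop :=
  2 * cπ * I * (κ : ℂ) * deriv (fun t => u z t) τ =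
    iteratedDeriv 2 (fun w => u w τ) z + (p : ℂ) * ((p : ℂ) + 1) * Rho' z τ * u z τ


noncomputable def APr (q x : ℂ) : ℂ := ∏' n : ℕ, (1 - q ^ (n + 1) * x)

lemma APr_summable {q : ℂ} (hq : ‖q‖ < 1) (x : ℂ) :
    Summable fun n : ℕ => ‖-(q ^ (n + 1) * x)‖ := by
  have := ((summable_nat_add_iff 1).mpr (summable_geometric_of_lt_one (norm_nonneg _) hq)).mul_right ‖x‖
  simpa using this

lemma APr_mult {q : ℂ} (hq : ‖q‖ < 1) (x : ℂ) :
    Multipliable fun n : ℕ => (1 - q ^ (n + 1) * x) := by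
  simp_rw [sub_eq_add_neg]
  exact multipliable_one_add_of_summable (APr_summable hq x)

lemma APr_diff {q : ℂ} (hq : ‖q‖ < 1) : Differentiable ℂ (APr q) := by
  have hm : HasProdLocallyUniformlyOn (fun (n : ℕ) (x : ℂ) => 1 - q ^ (n + 1) * x) (APr q)
      Set.univ := by
    unfold APr
    simp_rw [sub_eq_add_neg]
    apply hasProdLocallyUniformlyOn_of_forall_compact isOpen_univ
    intro K hK hcK
    obtain ⟨C, hC⟩ := hcK.isBounded.exists_norm_le
    refine (((summable_nat_add_iff 1).mpr (summable_geometric_of_lt_one (norm_nonneg _)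
      hq)).mul_right C).hasProdUniformlyOn_nat_one_add
      hcK (.of_forall fun n x hx ↦ ?_) (fun _ ↦ by fun_prop)
    simp only [norm_neg, norm_mul, norm_pow]
    exact mul_le_mul_of_nonneg_left (hC x hx) (by positivity)
  rw [← differentiableOn_univ]
  exact hm.differentiableOn
    (.of_forall fun _ ↦ by simpa [Finset.prod_fn] using
      DifferentiableOn.finsetProd (fun _ _ ↦ by fun_prop)) isOpen_univ

lemma APr_eq_zero {q : ℂ} (hq : ‖q‖ < 1) {x : ℂ} (h : APr q x = 0) :
    ∃ n : ℕ, q ^ (n + 1) * x = 1 := by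
  by_contra! hne
  refine tprod_one_add_ne_zero_of_summable (f := fun n : ℕ ↦ -(q ^ (n + 1) * x)) ?_ ?_ ?_
  · intro n hn
    exact hne n (by linear_combination -hn)
  · exact APr_summable hq x
  · simpa [APr, sub_eq_add_neg] using h

lemma APr_shift {q : ℂ} (hq : ‖q‖ < 1) (hq0 : q ≠ 0) (x : ℂ) :
    APr q (x / q) = (1 - x) * APr q x := by
  unfold APr
  rw [tprod_eq_zero_mul']
  · congr 1
    · simp; field_simp
    · refine tprod_congr fun n => ?_
      field_simp
      ring
  · convert APr_mult hq x using 2 with n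
    field_simp
    ring

noncomputable abbrev qq (τ : ℂ) : ℂ := exp (2 * cπ * I * τ)

lemma qq_norm {τ : ℂ} (h : 0 < τ.im) : ‖qq τ‖ < 1 := by
  rw [qq, Complex.norm_exp, Real.exp_lt_one_iff]
  have : (2 * cπ * I * τ).re = - (2 * Real.pi * τ.im) := by simp [cπ]
  rw [this]
  have := Real.pi_pos
  nlinarith [mul_pos this h]

lemma JT_eq {τ : ℂ} (h : 0 < τ.im) (z : ℂ) : JTheta1 z τ =
    2 * exp (cπ * I * τ / 4) * sin (cπ * z) *
      (APr (qq τ) (exp (2 * cπ * I * z)) * APr (qq τ) (exp (-(2 * cπ * I * z))) * APr (qq τ) 1) := by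
  have hq := qq_norm h
  unfold JTheta1 APr
  rw [← Multipliable.tprod_mul (APr_mult hq _) (APr_mult hq _),
    ← Multipliable.tprod_mul ((APr_mult hq _).mul (APr_mult hq _)) (APr_mult hq _)]
  simp

lemma JT_diff {τ : ℂ} (h : 0 < τ.im) : Differentiable ℂ (fun z => JTheta1 z τ) := by
  have hd := APr_diff (qq_norm h)
  have h1 : Differentiable ℂ (fun z => APr (qq τ) (exp (2 * cπ * I * z))) :=
    hd.comp (by fun_prop)
  have h2 : Differentiable ℂ (fun z => APr (qq τ) (exp (-(2 * cπ * I * z)))) :=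
    hd.comp (by fun_prop)
  simp_rw [JT_eq h]
  fun_prop

lemma JT_add_one {τ : ℂ} (h : 0 < τ.im) (z : ℂ) : JTheta1 (z + 1) τ = - JTheta1 z τ := by
  have e1 : exp (2 * cπ * I * (z + 1)) = exp (2 * cπ * I * z) := by
    rw [mul_add, Complex.exp_add, mul_one, cπ, Complex.exp_two_pi_mul_I, mul_one]
  rw [JT_eq h, JT_eq h, Complex.exp_neg, Complex.exp_neg, e1]
  have : sin (cπ * (z + 1)) = - sin (cπ * z) := by
    rw [mul_add, mul_one, cπ, Complex.sin_add_pi]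
  rw [this]; ring

lemma sin_cpi (z : ℂ) : 2 * sin (cπ * z) = I * exp (-(cπ * I * z)) * (1 - exp (2 * cπ * I * z)) := by
  rw [Complex.sin, show 2 * cπ * I * z = cπ * I * z + cπ * I * z by ring, Complex.exp_add,
    show -(cπ * z) * I = -(cπ * I * z) by ring, show (cπ * z) * I = (cπ * I * z) by ring,
    Complex.exp_neg]
  have := Complex.exp_ne_zero (cπ * I * z)
  field_simp

lemma JT_add_tau {τ : ℂ} (h : 0 < τ.im) (z : ℂ) :
    JTheta1 (z + τ) τ = - exp (-(2 * cπ * I * z) - cπ * I * τ) * JTheta1 z τ := by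
  have hq := qq_norm h
  have hq0 : qq τ ≠ 0 := Complex.exp_ne_zero _
  rw [JT_eq h, JT_eq h]
  set x := exp (2 * cπ * I * z) with hx
  have hx0 : x ≠ 0 := Complex.exp_ne_zero _
  have e1 : exp (2 * cπ * I * (z + τ)) = qq τ * x := by
    rw [mul_add, Complex.exp_add, mul_comm]
  have s1 := sin_cpi z
  have s2 := sin_cpi (z + τ)
  have a1 := APr_shift hq hq0 (qq τ * x)
  rw [mul_div_cancel_left₀ _ hq0] at a1
  have a2 := APr_shift hq hq0 x⁻¹
  rw [Complex.exp_neg, Complex.exp_neg, e1]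
  rw [e1] at s2
  rw [← hx] at s1 ⊢
  rw [show (qq τ * x)⁻¹ = x⁻¹ / qq τ by field_simp, a2, a1]
  have e3 : exp (-(2 * cπ * I * z) - cπ * I * τ) * exp (-(cπ * I * z)) = x⁻¹ * exp (-(cπ * I * (z + τ))) := by
    rw [hx, ← Complex.exp_neg, ← Complex.exp_add, ← Complex.exp_add]
    congr 1; ring
  have hxx : x * x⁻¹ = 1 := mul_inv_cancel₀ hx0
  linear_combination (exp (cπ * I * τ / 4) * (APr (qq τ) (qq τ * x)) * ((1 - x⁻¹) * APr (qq τ) x⁻¹) * APr (qq τ) 1) * s2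
   + exp (-(2 * cπ * I * z) - cπ * I * τ) * (exp (cπ * I * τ / 4) * ((1 - qq τ * x) * APr (qq τ) (qq τ * x)) * (APr (qq τ) x⁻¹) * APr (qq τ) 1) * s1
   + (exp (cπ * I * τ / 4) * APr (qq τ) (qq τ * x) * APr (qq τ) x⁻¹ * APr (qq τ) 1 * I *
      (1 - qq τ * x) * (1 - x)) * e3
   - (exp (cπ * I * τ / 4) * APr (qq τ) (qq τ * x) * APr (qq τ) x⁻¹ * APr (qq τ) 1 * I *
      (1 - qq τ * x) * exp (-(cπ * I * (z + τ)))) * hxx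

lemma elliptic_ratio (P G e1 e2 : ℂ → ℂ) (τ : ℂ) (hτ : 0 < τ.im)
    (hP : Differentiable ℂ P) (hG : Differentiable ℂ G)
    (hz : ∀ z, P z = 0 → G z = 0 ∧ deriv P z ≠ 0)
    (h1 : ∀ z, e1 z ≠ 0) (h2 : ∀ z, e2 z ≠ 0)
    (hP1 : ∀ z, P (z + 1) = e1 z * P z) (hG1 : ∀ z, G (z + 1) = e1 z * G z)
    (hP2 : ∀ z, P (z + τ) = e2 z * P z) (hG2 : ∀ z, G (z + τ) = e2 z * G z) :
    ∃ c, ∀ z, G z = c * P z := by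
  classical
  let H : ℂ → ℂ := fun z => if P z = 0 then deriv G z / deriv P z else G z / P z
  have hne : ∀ z, ∀ᶠ w in nhdsWithin z {z}ᶜ, P w ≠ 0 := by
    intro z
    by_cases h : P z = 0
    · have := (hP z).hasDerivAt.eventually_ne (hz z h).2 (c := 0)
      simpa using this
    · exact ((hP z).continuousAt.eventually_ne h).filter_mono nhdsWithin_le_nhds
  have hds : ∀ (F : ℂ → ℂ) (z : ℂ), Differentiable ℂ F → Differentiable ℂ (dslope F z) := by
    intro F z hF
    rw [← differentiableOn_univ, Complex.differentiableOn_dslope Filter.univ_mem]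
    exact hF.differentiableOn
  have hH : Differentiable ℂ H := by
    intro z
    by_cases h : P z = 0
    · have hD : dslope P z z ≠ 0 := by rw [dslope_same]; exact (hz z h).2
      have : DifferentiableAt ℂ (fun w => dslope G z w / dslope P z w) z :=
        (hds G z hG z).div (hds P z hP z) hD
      refine this.congr_of_eventuallyEq ?_
      have hn := hne z
      rw [eventually_nhdsWithin_iff] at hn
      filter_upwards [hn] with w hw
      by_cases hwz : w = z
      · subst hwz
        simp [H, h]
      · have hw' := hw hwz
        have hs : w - z ≠ 0 := sub_ne_zero.2 hwz
        simp only [H, hw', if_false]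
        rw [dslope_of_ne _ hwz, dslope_of_ne _ hwz, slope_def_field, slope_def_field, h, (hz z h).1]
        simp only [sub_zero]
        field_simp
    · refine ((hG z).div (hP z) h).congr_of_eventuallyEq ?_
      filter_upwards [(hP z).continuousAt.eventually_ne h] with w hw
      simp [H, hw]
  have hper : ∀ (e : ℂ → ℂ) (ω : ℂ), (∀ z, e z ≠ 0) → (∀ z, P (z + ω) = e z * P z) →
      (∀ z, G (z + ω) = e z * G z) → Function.Periodic H ω := by
    intro e ω he hPe hGe z
    have hc1 : Filter.Tendsto (fun w => H (w + ω)) (nhdsWithin z {z}ᶜ) (nhds (H (z + ω))) := by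
      have : Continuous (fun w => H (w + ω)) := hH.continuous.comp (by fun_prop)
      exact this.continuousAt.tendsto.mono_left nhdsWithin_le_nhds
    have hc2 : Filter.Tendsto H (nhdsWithin z {z}ᶜ) (nhds (H z)) :=
      hH.continuous.continuousAt.tendsto.mono_left nhdsWithin_le_nhds
    refine tendsto_nhds_unique_of_eventuallyEq hc1 hc2 ?_
    filter_upwards [hne z] with w hw
    have := he w
    simp only [H, hPe, hGe, hw, mul_eq_zero, this, or_self, if_false]
    field_simp
  have p1 := hper e1 1 h1 hP1 hG1
  have p2 := hper e2 τ h2 hP2 hG2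
  have hb : Bornology.IsBounded (Set.range H) := by
    let φ : ℝ × ℝ → ℂ := fun x => H (x.1 + x.2 * τ)
    have hφ : Continuous φ := hH.continuous.comp (by fun_prop)
    have hcomp : IsCompact (φ '' (Set.Icc 0 1 ×ˢ Set.Icc 0 1)) :=
      (isCompact_Icc.prod isCompact_Icc).image hφ
    refine hcomp.isBounded.subset ?_
    rintro _ ⟨z, rfl⟩
    set t := z.im / τ.im with ht
    set s := (z - t * τ).re with hs
    have hzst : z = s + t * τ := by
      apply Complex.ext
      · simp [hs]
      · simp [ht]; field_simp
    refine ⟨(Int.fract s, Int.fract t), ⟨⟨Int.fract_nonneg _, (Int.fract_lt_one _).le⟩,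
      ⟨Int.fract_nonneg _, (Int.fract_lt_one _).le⟩⟩, ?_⟩
    have q1 := p1.sub_zsmul_eq (x := z - ⌊t⌋ • τ) ⌊s⌋
    have q2 := p2.sub_zsmul_eq (x := z) ⌊t⌋
    rw [← q2, ← q1]
    simp only [φ]
    congr 1
    rw [hzst]
    simp only [Int.fract, zsmul_eq_mul, mul_one]
    push_cast
    ring
  refine ⟨H 0, fun z => ?_⟩
  rw [hH.apply_eq_apply_of_bounded hb 0 z]
  by_cases h : P z = 0
  · simp [h, (hz z h).1]
  · simp [H, h]

def QPer (P : ℂ → ℂ) (ω : ℂ) : Prop :=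
  ∃ g : ℂ → ℂ, Differentiable ℂ g ∧ (∀ z, g z ≠ 0) ∧ ∀ z, P (z + ω) = g z * P z

lemma QPer.add {P : ℂ → ℂ} {a b : ℂ} (ha : QPer P a) (hb : QPer P b) : QPer P (a + b) := by
  obtain ⟨f, f1, f2, f3⟩ := ha
  obtain ⟨g, g1, g2, g3⟩ := hb
  refine ⟨fun z => g (z + a) * f z, (g1.comp (by fun_prop)).mul f1, fun z => mul_ne_zero (g2 _) (f2 _),
    fun z => ?_⟩
  rw [← add_assoc, g3, f3]; ring

lemma QPer.neg {P : ℂ → ℂ} {a : ℂ} (ha : QPer P a) : QPer P (-a) := by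
  obtain ⟨f, f1, f2, f3⟩ := ha
  have hc : Differentiable ℂ (fun z => f (z + -a)) := f1.comp (by fun_prop)
  refine ⟨fun z => (f (z + -a))⁻¹, hc.inv (fun z => f2 _), fun z => inv_ne_zero (f2 _),
    fun z => ?_⟩
  have := f3 (z + -a)
  rw [neg_add_cancel_right] at this
  rw [this]
  field_simp [f2]

lemma QPer.zsmul {P : ℂ → ℂ} {a : ℂ} (ha : QPer P a) (n : ℤ) : QPer P (n * a) := by
  induction n with
  | zero => exact ⟨fun _ => 1, by fun_prop, by simp, by simp⟩
  | succ n ih => 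
    have := ih.add ha
    convert this using 1; push_cast; ring
  | pred n ih =>
    have := ih.add ha.neg
    convert this using 1; push_cast; ring

lemma JT_QPer {τ : ℂ} (h : 0 < τ.im) (m n : ℤ) : QPer (fun z => JTheta1 z τ) (m + n * τ) := by
  have h1 : QPer (fun z => JTheta1 z τ) 1 :=
    ⟨fun _ => -1, by fun_prop, by simp, fun z => by simp only; rw [JT_add_one h]; ring⟩
  have h2 : QPer (fun z => JTheta1 z τ) τ :=
    ⟨fun z => - exp (-(2 * cπ * I * z) - cπ * I * τ), by fun_prop,
      fun z => neg_ne_zero.2 (Complex.exp_ne_zero _), fun z => JT_add_tau h z⟩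
  have := (h1.zsmul m).add (h2.zsmul n)
  rwa [mul_one] at this

lemma exp_cpi_eq_one {w : ℂ} (h : exp (2 * cπ * I * w) = 1) : ∃ m : ℤ, w = m := by
  rw [Complex.exp_eq_one_iff] at h
  obtain ⟨m, hm⟩ := h
  refine ⟨m, ?_⟩
  have : (2 * (Real.pi : ℂ) * I) ≠ 0 := Complex.two_pi_I_ne_zero
  rw [cπ] at hm
  apply mul_left_cancel₀ this
  rw [hm]; ring

lemma APr_one_ne {τ : ℂ} (h : 0 < τ.im) : APr (qq τ) 1 ≠ 0 := by
  intro h0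
  obtain ⟨n, hn⟩ := APr_eq_zero (qq_norm h) h0
  have := congrArg norm hn
  rw [mul_one, norm_pow, norm_one] at this
  exact (pow_lt_one₀ (norm_nonneg _) (qq_norm h) (by omega)).ne this

lemma JT_zero {τ : ℂ} (h : 0 < τ.im) : JTheta1 0 τ = 0 := by
  rw [JT_eq h]; simp

lemma JT_deriv_zero {τ : ℂ} (h : 0 < τ.im) : deriv (fun z => JTheta1 z τ) 0 ≠ 0 := by
  have hd := APr_diff (qq_norm h)
  have h1 : Differentiable ℂ (fun z => APr (qq τ) (exp (2 * cπ * I * z))) :=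
    hd.comp (by fun_prop)
  have h2 : Differentiable ℂ (fun z => APr (qq τ) (exp (-(2 * cπ * I * z)))) :=
    hd.comp (by fun_prop)
  have h3 : HasDerivAt (fun z => 2 * exp (cπ * I * τ / 4) * sin (cπ * z))
      (2 * exp (cπ * I * τ / 4) * cπ) 0 := by
    have : HasDerivAt (fun z : ℂ => cπ * z) cπ 0 := by simpa using (hasDerivAt_id (0:ℂ)).const_mul cπ
    have := (this.csin).const_mul (2 * exp (cπ * I * τ / 4))
    simpa using this
  have h4 : Differentiable ℂ (fun z => (APr (qq τ) (exp (2 * cπ * I * z)) * APr (qq τ) (exp (-(2 * cπ * I * z))) * APr (qq τ) 1)) := by fun_prop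
  have h5 := h3.mul (h4 0).hasDerivAt
  have h6 : (fun z => JTheta1 z τ) = (fun z => 2 * exp (cπ * I * τ / 4) * sin (cπ * z)) * (fun z => (APr (qq τ) (exp (2 * cπ * I * z)) * APr (qq τ) (exp (-(2 * cπ * I * z))) * APr (qq τ) 1)) := by
    funext z; exact JT_eq h z
  rw [h6, h5.deriv]
  have := APr_one_ne h
  have hpi : cπ ≠ 0 := by simp [cπ]
  simp [this, hpi]

lemma JT_lattice {τ : ℂ} (h : 0 < τ.im) {z : ℂ} (hz : JTheta1 z τ = 0) :
    ∃ m n : ℤ, z = m + n * τ := by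
  have hq := qq_norm h
  have key : ∀ (n : ℕ) (w : ℂ), qq τ ^ (n + 1) * exp (2 * cπ * I * w) = 1 → ∃ m : ℤ, w + (n + 1) * τ = m := by
    intro n w hw
    apply exp_cpi_eq_one
    refine Eq.trans ?_ hw
    rw [qq, ← Complex.exp_nat_mul, ← Complex.exp_add]
    congr 1; push_cast; ring
  rw [JT_eq h] at hz
  simp only [mul_eq_zero, Complex.exp_ne_zero, APr_one_ne h, or_false, OfNat.ofNat_ne_zero, false_or] at hz
  rcases hz with hz | hz | hz
  · have s := sin_cpi z
    rw [hz, mul_zero] at s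
    have : exp (2 * cπ * I * z) = 1 := by
      have := mul_eq_zero.1 s.symm
      simp [Complex.exp_ne_zero] at this
      linear_combination -this
    obtain ⟨m, hm⟩ := exp_cpi_eq_one this
    exact ⟨m, 0, by simp [hm]⟩
  · obtain ⟨n, hn⟩ := APr_eq_zero hq hz
    obtain ⟨m, hm⟩ := key n z hn
    exact ⟨m, -(n + 1), by push_cast; linear_combination hm⟩
  · obtain ⟨n, hn⟩ := APr_eq_zero hq hz
    obtain ⟨m, hm⟩ := key n (-z) (by rw [← hn]; congr 2; ring)
    exact ⟨-m, (n + 1), by push_cast; linear_combination -hm⟩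

lemma JT_at_lattice {τ : ℂ} (h : 0 < τ.im) (m n : ℤ) :
    JTheta1 (m + n * τ) τ = 0 ∧ deriv (fun z => JTheta1 z τ) (m + n * τ) ≠ 0 := by
  obtain ⟨g, g1, g2, g3⟩ := JT_QPer h m n
  have e0 := g3 0
  simp only [zero_add, JT_zero h, mul_zero] at e0
  refine ⟨e0, ?_⟩
  have d1 : deriv (fun z => JTheta1 (z + (m + n * τ)) τ) 0 = deriv (fun z => JTheta1 z τ) (m + n * τ) := by
    have := deriv_comp_add_const (f := fun z => JTheta1 z τ) (m + n * τ) 0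
    simpa using this
  have d2 : deriv (fun z => JTheta1 (z + (m + n * τ)) τ) 0 = g 0 * deriv (fun z => JTheta1 z τ) 0 := by
    have : (fun z => JTheta1 (z + (m + n * τ)) τ) = g * (fun z => JTheta1 z τ) := by
      funext z; exact g3 z
    rw [this, deriv_mul (g1 0) (JT_diff h 0), JT_zero h]
    simp
  rw [← d1, d2]
  exact mul_ne_zero (g2 0) (JT_deriv_zero h)

lemma JT_S {τ : ℂ} (h : 0 < τ.im) : ∃ c : ℂ, c ≠ 0 ∧
    ∀ z, JTheta1 (z / τ) (-1 / τ) = c * exp (cπ * I * z ^ 2 / τ) * JTheta1 z τ := by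
  have hτ0 : τ ≠ 0 := by rintro rfl; simp at h
  have hs : 0 < (-1 / τ).im := by
    rw [neg_div, one_div, Complex.neg_im, Complex.inv_im, neg_div, neg_neg]
    exact div_pos h (Complex.normSq_pos.2 hτ0)
  have hGd : Differentiable ℂ (fun z => JTheta1 (z / τ) (-1 / τ)) :=
    (JT_diff hs).comp (by fun_prop)
  have main : ∃ c : ℂ, ∀ z, exp (-(cπ * I * z ^ 2 / τ)) * JTheta1 (z / τ) (-1 / τ) =
      c * JTheta1 z τ := by
    refine elliptic_ratio (fun z => JTheta1 z τ)
      (fun z => exp (-(cπ * I * z ^ 2 / τ)) * JTheta1 (z / τ) (-1 / τ))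
      (fun _ => -1) (fun z => - exp (-(2 * cπ * I * z) - cπ * I * τ)) τ h (JT_diff h)
      (by fun_prop) ?_ (by simp) (by simp [Complex.exp_ne_zero]) ?_ ?_ ?_ ?_
    · intro z hz
      obtain ⟨m, n, rfl⟩ := JT_lattice h hz
      refine ⟨?_, (JT_at_lattice h m n).2⟩
      have := (JT_at_lattice hs n (-m)).1
      rw [show ((m : ℂ) + n * τ) / τ = (n : ℂ) + ((-m : ℤ) : ℂ) * (-1 / τ) by push_cast; field_simp; ring,
        this, mul_zero]
    · intro z; rw [JT_add_one h]; ring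
    · intro z
      have := JT_add_tau hs ((z + 1) / τ)
      rw [show (z + 1) / τ + -1 / τ = z / τ by ring] at this
      rw [this]
      have e : exp (-(cπ * I * z ^ 2 / τ)) * exp (-(2 * cπ * I * ((z + 1) / τ)) - cπ * I * (-1 / τ)) =
          exp (-(cπ * I * (z + 1) ^ 2 / τ)) := by
        rw [← Complex.exp_add]; congr 1; field_simp; ring
      rw [← e]; ring
    · intro z; exact JT_add_tau h z
    · intro z
      rw [show (z + τ) / τ = z / τ + 1 by field_simp, JT_add_one hs]
      have e : exp (-(2 * cπ * I * z) - cπ * I * τ) * exp (-(cπ * I * z ^ 2 / τ)) =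
          exp (-(cπ * I * (z + τ) ^ 2 / τ)) := by
        rw [← Complex.exp_add]; congr 1; field_simp; ring
      rw [← e]; ring
  obtain ⟨c, hc⟩ := main
  · refine ⟨c, ?_, fun z => ?_⟩
    · rintro rfl
      have : (fun z => JTheta1 z (-1 / τ)) = fun _ => 0 := by
        funext w
        have := hc (w * τ)
        simpa [Complex.exp_ne_zero, hτ0] using this
      exact JT_deriv_zero hs (by rw [this]; simp)
    · have := hc z
      rw [Complex.exp_neg] at this
      have he := Complex.exp_ne_zero (cπ * I * z ^ 2 / τ)
      rw [mul_right_comm, ← this]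
      field_simp

lemma S_im_pos {τ : ℂ} (h : 0 < τ.im) : 0 < (-1 / τ).im := by
  have hτ0 : τ ≠ 0 := by rintro rfl; simp at h
  rw [neg_div, one_div, Complex.neg_im, Complex.inv_im, neg_div, neg_neg]
  exact div_pos h (Complex.normSq_pos.2 hτ0)

lemma Rho_S {τ : ℂ} (h : 0 < τ.im) {z : ℂ} (hz : JTheta1 z τ ≠ 0) :
    Rho (z / τ) (-1 / τ) = 2 * cπ * I * z + τ * Rho z τ := by
  have hτ0 : τ ≠ 0 := by rintro rfl; simp at h
  have hs := S_im_pos h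
  obtain ⟨c, hc0, hc⟩ := JT_S h
  have hd := JT_diff h z
  have hds := JT_diff hs (z / τ)
  have dd : HasDerivAt (fun w : ℂ => w / τ) (1 / τ) z := (hasDerivAt_id z).div_const τ
  have d1 : HasDerivAt (fun w => JTheta1 (w / τ) (-1 / τ))
      (deriv (fun w => JTheta1 w (-1 / τ)) (z / τ) * (1 / τ)) z :=
    HasDerivAt.comp (h₂ := fun w => JTheta1 w (-1 / τ)) z hds.hasDerivAt dd
  have d2 : HasDerivAt (fun w => cexp (cπ * I * w ^ 2 / τ)) (cexp (cπ * I * z ^ 2 / τ) * (cπ * I * (2 * z) / τ)) z := by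
    have := (((hasDerivAt_pow 2 z).const_mul (cπ * I)).div_const τ).cexp
    simpa using this
  have d3 := (d2.const_mul c).mul hd.hasDerivAt
  have e : (fun w => JTheta1 (w / τ) (-1 / τ)) = (fun w => c * exp (cπ * I * w ^ 2 / τ)) * (fun w => JTheta1 w τ) := by
    funext w; exact hc w
  rw [e] at d1
  have := d1.unique d3
  unfold Rho
  have hE := Complex.exp_ne_zero (cπ * I * z ^ 2 / τ)
  rw [hc]
  field_simp at this ⊢
  linear_combination this

lemma Rho'_S {τ : ℂ} (h : 0 < τ.im) {z : ℂ} (hz : JTheta1 z τ ≠ 0) :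
    JTheta1 (z / τ) (-1 / τ) ≠ 0 ∧ 
    Rho' (z / τ) (-1 / τ) = 2 * cπ * I * τ + τ ^ 2 * Rho' z τ := by
  have hτ0 : τ ≠ 0 := by rintro rfl; simp at h
  have hs := S_im_pos h
  have hzs : JTheta1 (z / τ) (-1 / τ) ≠ 0 := by
    obtain ⟨c, hc0, hc⟩ := JT_S h
    rw [hc]
    exact mul_ne_zero (mul_ne_zero hc0 (Complex.exp_ne_zero _)) hz
  refine ⟨hzs, ?_⟩
  have hR : ∀ (t w : ℂ), 0 < t.im → JTheta1 w t ≠ 0 → DifferentiableAt ℂ (fun w => Rho w t) w := by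
    intro t w ht hw
    exact ((JT_diff ht).deriv w).div (JT_diff ht w) hw
  have dd : HasDerivAt (fun w : ℂ => w / τ) (1 / τ) z := (hasDerivAt_id z).div_const τ
  have d1 : HasDerivAt (fun w => Rho (w / τ) (-1 / τ)) (Rho' (z / τ) (-1 / τ) * (1 / τ)) z :=
    HasDerivAt.comp (h₂ := fun w => Rho w (-1 / τ)) z (hR _ _ hs hzs).hasDerivAt dd
  have d2 : HasDerivAt (fun w => 2 * cπ * I * w + τ * Rho w τ) (2 * cπ * I * 1 + τ * Rho' z τ) z :=
    ((hasDerivAt_id z).const_mul _).add ((hR _ _ h hz).hasDerivAt.const_mul τ)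
  have d3 := d2.congr_of_eventuallyEq (f₁ := fun w => Rho (w / τ) (-1 / τ)) (by
    filter_upwards [(JT_diff h z).continuousAt.eventually_ne hz] with w hw
    exact Rho_S h hw)
  have := d1.unique d3
  have h2 : Rho' (z / τ) (-1 / τ) = Rho' (z / τ) (-1 / τ) * (1 / τ) * τ := by field_simp
  rw [h2, this]; ring

section Hartogs
open MeasureTheory Metric Set Filter Topology

lemma jensen_two_const {f : ℂ → ℂ} {c : ℂ} {s δ : ℝ} (hs : 0 < s)
    (hf : AnalyticOnNhd ℂ f (closedBall c s)) (hb : ∀ z ∈ closedBall c s, ‖f z‖ ≤ 1)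
    (hδ : 0 < δ)
    (hvol : volume {θ ∈ Ioo (-Real.pi) Real.pi | δ < ‖f (circleMap c s θ)‖} ≤
      ENNReal.ofReal Real.pi) : ‖f c‖ ^ 2 ≤ δ := by
  have hpi := Real.pi_pos
  have hcm : c ∈ closedBall c s := by simp [hs.le]
  by_cases hfc : f c = 0
  · simp [hfc, hδ.le]
  by_cases hδ1 : 1 ≤ δ
  · have := hb c hcm
    have h0 := norm_nonneg (f c)
    nlinarith
  push Not at hδ1
  have habs : |s| = s := abs_of_pos hs
  have hlogδ : Real.log δ < 0 := Real.log_neg hδ hδ1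
  have hJ := AnalyticOnNhd.circleAverage_log_norm (c := c) (R := s) (f := f) hs.ne'
    (by rwa [habs]) hfc
  have hsum : 0 ≤ ∑ᶠ u, MeromorphicOn.divisor f (closedBall c |s|) u *
      Real.log (s * ‖c - u‖⁻¹) := by
    apply finsum_nonneg
    intro u
    by_cases hu : u ∈ closedBall c |s|
    · apply mul_nonneg
      · have := (MeromorphicOn.AnalyticOnNhd.divisor_nonneg (habs.symm ▸ hf)) u
        exact_mod_cast this
      · by_cases hcu : c = u
        · simp [hcu]
        · apply Real.log_nonneg
          have h1 : 0 < ‖c - u‖ := norm_pos_iff.2 (sub_ne_zero.2 hcu)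
          rw [← div_eq_mul_inv, le_div_iff₀ h1, one_mul]
          rw [habs, mem_closedBall, dist_comm, dist_eq_norm] at hu
          exact hu
    · simp [hu]
  let g : ℂ → ℝ := fun z => if f z = 0 then Real.log δ else Real.log ‖f z‖
  let h : ℂ → ℝ := fun z => if δ < ‖f z‖ then 0 else Real.log δ
  have hsph : sphere c |s| ⊆ closedBall c s := by rw [habs]; exact sphere_subset_closedBall
  have hcod : f ⁻¹' {0}ᶜ ∈ codiscreteWithin (sphere c |s|) :=
    Filter.codiscreteWithin_mono hsph
      (hf.preimage_zero_mem_codiscreteWithin hfc hcm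
        ⟨⟨c, hcm⟩, (convex_closedBall c s).isPreconnected⟩)
  have hgf : (fun z => Real.log ‖f z‖) =ᶠ[codiscreteWithin (sphere c |s|)] g := by
    filter_upwards [hcod] with z hz
    have : f z ≠ 0 := hz
    simp [g, this]
  have hci : CircleIntegrable (fun z => Real.log ‖f z‖) c s :=
    MeromorphicOn.circleIntegrable_log_norm (fun z hz => (hf z (hsph hz)).meromorphicAt)
  have hgi : CircleIntegrable g c s := CircleIntegrable.congr_codiscreteWithin hgf hci
  have hcont : Continuous (fun θ => f (circleMap c s θ)) := by
    apply hf.continuousOn.comp_continuous (continuous_circleMap c s)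
    intro θ
    exact circleMap_mem_closedBall c hs.le θ
  set Bd : Set ℝ := {θ | δ < ‖f (circleMap c s θ)‖} with hBd
  have hBm : MeasurableSet Bd := (isOpen_lt continuous_const hcont.norm).measurableSet
  have hh : (fun θ => h (circleMap c s θ)) = Bdᶜ.indicator (fun _ => Real.log δ) := by
    ext θ
    simp only [h, indicator, hBd, mem_compl_iff, mem_ofPred_eq]
    split_ifs <;> simp_all
  have hhi : CircleIntegrable h c s := by
    unfold CircleIntegrable
    rw [hh, intervalIntegrable_iff_integrableOn_Ioc_of_le (by linarith)]
    exact (integrable_const _).indicator hBm.compl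
  have hmono : Real.circleAverage g c s ≤ Real.circleAverage h c s := by
    apply Real.circleAverage_mono hgi hhi
    intro z hz
    have hz1 := hb z (hsph hz)
    simp only [g, h]
    split_ifs with h1 h2 h2
    · exact hlogδ.le
    · exact le_rfl
    · exact Real.log_nonpos (norm_nonneg _) hz1
    · exact Real.log_le_log (norm_pos_iff.2 h1) (not_lt.1 h2)
  have hav : Real.circleAverage h c s ≤ Real.log δ / 2 := by
    rw [Real.circleAverage_eq_integral_add (-Real.pi),
      intervalIntegral.integral_comp_add_right (fun θ => h (circleMap c s θ)), hh]
    rw [show (0:ℝ) + -Real.pi = -Real.pi by ring, show 2 * Real.pi + -Real.pi = Real.pi by ring,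
      intervalIntegral.integral_of_le (by linarith), integral_Ioc_eq_integral_Ioo,
      integral_indicator hBm.compl, setIntegral_const]
    have hreal : Real.pi ≤ (volume.restrict (Ioo (-Real.pi) Real.pi)).real Bdᶜ := by
      have h1 : (volume.restrict (Ioo (-Real.pi) Real.pi)).real Bd ≤ Real.pi := by
        rw [measureReal_def, Measure.restrict_apply hBm]
        apply ENNReal.toReal_le_of_le_ofReal hpi.le
        refine le_trans (measure_mono ?_) hvol
        rintro θ ⟨h1, h2⟩
        exact ⟨h2, h1⟩
      have h2 := measureReal_compl (μ := volume.restrict (Ioo (-Real.pi) Real.pi)) hBm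
      have h3 : (volume.restrict (Ioo (-Real.pi) Real.pi)).real univ = 2 * Real.pi := by
        simp [measureReal_def]
        rw [ENNReal.toReal_ofReal (by linarith)]; ring
      rw [h2, h3]; linarith
    rw [smul_eq_mul, smul_eq_mul]
    have : (volume.restrict (Ioo (-Real.pi) Real.pi)).real Bdᶜ * Real.log δ
        ≤ Real.pi * Real.log δ := mul_le_mul_of_nonpos_right hreal hlogδ.le
    calc _ ≤ (2 * Real.pi)⁻¹ * (Real.pi * Real.log δ) := by gcongr
      _ = _ := by field_simp
  rw [Real.circleAverage_congr_codiscreteWithin hgf hs.ne'] at hJ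
  have hfin : Real.log (‖f c‖ ^ 2) ≤ Real.log δ := by
    rw [Real.log_pow]; push_cast; linarith
  have : 0 < ‖f c‖ := norm_pos_iff.2 hfc
  exact (Real.log_le_log_iff (by positivity) hδ).1 hfin

lemma exists_good_radius {B : Set ℂ} (hB : MeasurableSet B) (c : ℂ) {ρ : ℝ} (hρ : 0 < ρ)
    (hv : volume B < ENNReal.ofReal (Real.pi * ρ ^ 2)) :
    ∃ s ∈ Icc ρ (2 * ρ), volume {θ ∈ Ioo (-Real.pi) Real.pi | circleMap c s θ ∈ B} ≤
      ENNReal.ofReal Real.pi := by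
  by_contra hcon
  push Not at hcon
  have hpi := Real.pi_pos
  apply absurd hv
  rw [not_lt]
  have e1 : volume B = ∫⁻ p, B.indicator 1 (c + p) := by
    rw [lintegral_add_left_eq_self (fun p => B.indicator (1 : ℂ → ENNReal) p) c,
      lintegral_indicator_one hB]
  have hmeas : Measurable (fun p : ℝ × ℝ => ENNReal.ofReal p.1 *
      B.indicator (1 : ℂ → ENNReal) (circleMap c p.1 p.2)) := by
    apply Measurable.mul (by fun_prop)
    apply (measurable_one.indicator hB).comp
    unfold circleMap
    fun_prop
  rw [e1, ← Complex.lintegral_comp_polarCoord_symm]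
  have e2 : ∀ p : ℝ × ℝ, ENNReal.ofReal p.1 • B.indicator (1 : ℂ → ENNReal)
      (c + Complex.polarCoord.symm p) = ENNReal.ofReal p.1 *
      B.indicator (1 : ℂ → ENNReal) (circleMap c p.1 p.2) := by
    intro p
    rw [smul_eq_mul, Complex.polarCoord_symm_apply, circleMap, Complex.exp_mul_I]
    push_cast; rfl
  simp_rw [e2]
  rw [polarCoord_target, Measure.volume_eq_prod, ← Measure.prod_restrict,
    lintegral_prod _ hmeas.aemeasurable]
  have hin : ∀ x ∈ Icc ρ (2 * ρ), ENNReal.ofReal (ρ * Real.pi) ≤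
      ∫⁻ y in Ioo (-Real.pi) Real.pi, ENNReal.ofReal x *
        B.indicator (1 : ℂ → ENNReal) (circleMap c x y) := by
    intro x hx
    have hm2 : MeasurableSet {θ | circleMap c x θ ∈ B} := (continuous_circleMap c x).measurable hB
    have : ∀ y, B.indicator (1 : ℂ → ENNReal) (circleMap c x y) =
        {θ | circleMap c x θ ∈ B}.indicator 1 y := by
      intro y; simp [indicator]
    simp_rw [this]
    rw [lintegral_const_mul _ (measurable_one.indicator hm2), lintegral_indicator_one hm2,
      Measure.restrict_apply hm2, ENNReal.ofReal_mul hρ.le]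
    have h1 := (hcon x hx).le
    gcongr
    · exact hx.1
    · refine h1.trans (measure_mono ?_)
      rintro θ ⟨h1, h2⟩
      exact ⟨h2, h1⟩
  calc ENNReal.ofReal (Real.pi * ρ ^ 2) = ∫⁻ x in Icc ρ (2 * ρ), ENNReal.ofReal (ρ * Real.pi) := by
        rw [setLIntegral_const, Real.volume_Icc, ← ENNReal.ofReal_mul (by positivity)]
        congr 1; ring
    _ ≤ ∫⁻ x in Icc ρ (2 * ρ), ∫⁻ y in Ioo (-Real.pi) Real.pi, ENNReal.ofReal x *
        B.indicator (1 : ℂ → ENNReal) (circleMap c x y) :=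
        setLIntegral_mono' measurableSet_Icc hin
    _ ≤ _ := lintegral_mono_set (fun x hx => lt_of_lt_of_le hρ hx.1)


lemma hartogs_lemma {a : ℕ → ℂ → ℂ} {t0 : ℂ} {ρ M B : ℝ} (hρ : 0 < ρ) (hM : 1 ≤ M) (hB : 0 < B)
    (ha : ∀ n, DifferentiableOn ℂ (a n) (ball t0 (4 * ρ)))
    (hb : ∀ n, ∀ t ∈ ball t0 (4 * ρ), ‖a n t‖ ≤ M * B ^ n)
    (hp : ∀ t ∈ ball t0 (4 * ρ), ∀ ε > 0, ∃ N, ∀ n ≥ N, ‖a n t‖ ≤ ε ^ n) :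
    ∀ ε > 0, ∃ N, ∀ n ≥ N, ∀ t ∈ ball t0 ρ, ‖a n t‖ ≤ M * ε ^ n := by
  intro ε hε
  have hpi := Real.pi_pos
  set ε1 := ε ^ 2 / B with hε1
  have hε1p : 0 < ε1 := by positivity
  let Bd : ℕ → Set ℂ := fun N => ⋃ n ≥ N, (ball t0 (4 * ρ) ∩ (fun t => ‖a n t‖) ⁻¹' Ioi (ε1 ^ n))
  have hopen : ∀ N, IsOpen (Bd N) := fun N => isOpen_biUnion fun n _ =>
    (ha n).continuousOn.norm.isOpen_inter_preimage isOpen_ball isOpen_Ioi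
  have hanti : Antitone Bd := by
    intro N N' h
    exact biUnion_subset_biUnion_left (fun n (hn : n ≥ N') => le_trans h hn)
  have hsub : ∀ N, Bd N ⊆ ball t0 (4 * ρ) := fun N => iUnion₂_subset fun n _ => inter_subset_left
  have hempty : ⋂ N, Bd N = ∅ := by
    rw [eq_empty_iff_forall_notMem]
    intro t ht
    rw [mem_iInter] at ht
    have htb := hsub 0 (ht 0)
    obtain ⟨N, hN⟩ := hp t htb ε1 hε1p
    have := ht N
    simp only [Bd, mem_iUnion] at this
    obtain ⟨n, hn, -, h2⟩ := this
    exact absurd (hN n hn) (not_le.2 h2)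
  have hlim := tendsto_measure_iInter_atTop (μ := (volume : Measure ℂ)) (s := Bd)
    (fun N => (hopen N).measurableSet.nullMeasurableSet) hanti
    ⟨0, ((measure_mono (hsub 0)).trans_lt measure_ball_lt_top).ne⟩
  rw [hempty, measure_empty] at hlim
  have hev := hlim.eventually_lt_const (u := ENNReal.ofReal (Real.pi * ρ ^ 2))
    (ENNReal.ofReal_pos.2 (by positivity))
  obtain ⟨N, hN⟩ := hev.exists
  refine ⟨N, fun n hn c hc => ?_⟩
  obtain ⟨s, hs, hvol⟩ := exists_good_radius (hopen N).measurableSet c hρ hN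
  have hs0 : 0 < s := hρ.trans_le hs.1
  have hcb : closedBall c s ⊆ ball t0 (4 * ρ) := by
    intro x hx
    rw [mem_closedBall] at hx
    rw [mem_ball] at hc ⊢
    have := dist_triangle x c t0
    linarith [hs.2]
  have hMB : 0 < M * B ^ n := by positivity
  have hkey := jensen_two_const (f := fun t => a n t / ((M * B ^ n : ℝ) : ℂ)) (c := c) (s := s)
    (δ := (ε1 / B) ^ n) hs0 ?_ ?_ (by positivity) ?_
  · have hnn : ‖((M * B ^ n : ℝ) : ℂ)‖ = M * B ^ n := by
      rw [Complex.norm_real, Real.norm_of_nonneg hMB.le]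
    rw [norm_div, hnn] at hkey
    have h2 : ‖a n c‖ ^ 2 ≤ (M * ε ^ n) ^ 2 := by
      rw [div_pow, div_le_iff₀ (by positivity)] at hkey
      refine hkey.trans (le_of_eq ?_)
      rw [hε1]
      simp only [div_pow, mul_pow]
      field_simp
      ring
    exact (pow_le_pow_iff_left₀ (norm_nonneg _) (by positivity) two_ne_zero).1 h2
  · intro x hx
    exact ((ha n).analyticAt (isOpen_ball.mem_nhds (hcb hx))).div analyticAt_const
      (by exact_mod_cast hMB.ne')
  · intro x hx
    rw [norm_div, Complex.norm_real, Real.norm_of_nonneg hMB.le, div_le_one hMB]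
    exact hb n x (hcb hx)
  · refine le_trans (measure_mono ?_) hvol
    rintro θ ⟨h1, h2⟩
    refine ⟨h1, ?_⟩
    simp only [Bd, mem_iUnion]
    refine ⟨n, hn, hcb (circleMap_mem_closedBall c hs0.le θ), ?_⟩
    rw [norm_div, Complex.norm_real, Real.norm_of_nonneg hMB.le, lt_div_iff₀ hMB] at h2
    refine lt_of_le_of_lt ?_ h2
    rw [div_pow ε1 B n, div_mul_eq_mul_div, le_div_iff₀ (by positivity)]
    have : 0 < ε1 ^ n * B ^ n := by positivity
    nlinarith

/-- Separately holomorphic on `U × V` and locally bounded in the first variable,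
uniformly in the second. -/
def SepHol (U V : Set ℂ) (v : ℂ → ℂ → ℂ) : Prop :=
  (∀ t ∈ V, DifferentiableOn ℂ (fun w => v w t) U) ∧ (∀ z ∈ U, DifferentiableOn ℂ (v z) V) ∧
  (∀ z ∈ U, ∃ δ > 0, ∃ M, ball z δ ⊆ U ∧ ∀ w ∈ ball z δ, ∀ t ∈ V, ‖v w t‖ ≤ M)

lemma SepHol.deriv {U V : Set ℂ} {v : ℂ → ℂ → ℂ} (hU : IsOpen U) (hV : IsOpen V)
    (h : SepHol U V v) : SepHol U V (fun z t => deriv (fun w => v w t) z) := by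
  obtain ⟨h1, h2, h3⟩ := h
  refine ⟨fun t ht => (h1 t ht).deriv hU, fun z hz => ?_, fun z hz => ?_⟩
  · obtain ⟨δ, hδ, M, hsub, hM⟩ := h3 z hz
    have herr : ∀ t ∈ V, ∀ w ∈ ball z δ,
        dist (dslope (fun w => v w t) z w) (_root_.deriv (fun w => v w t) z) ≤
          (2 * ((2 * M) / δ)) / δ * dist w z := by
      intro t ht w hw
      have hd : DifferentiableOn ℂ (fun w => v w t) (ball z δ) := (h1 t ht).mono hsub
      have hm : MapsTo (fun w => v w t) (ball z δ) (closedBall (v z t) (2 * M)) := by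
        intro x hx
        rw [mem_closedBall, dist_eq_norm]
        have := norm_sub_le (v x t) (v z t)
        linarith [hM x hx t ht, hM z (mem_ball_self hδ) t ht]
      have hds : ∀ x ∈ ball z δ, ‖dslope (fun w => v w t) z x‖ ≤ (2 * M) / δ := fun x hx =>
        Complex.norm_dslope_le_div_of_mapsTo_ball hd hm hx
      have hd' : DifferentiableOn ℂ (dslope (fun w => v w t) z) (ball z δ) :=
        (Complex.differentiableOn_dslope (ball_mem_nhds z hδ)).2 hd
      have := Complex.dist_le_div_mul_dist_of_mapsTo_ball (R₂ := 2 * ((2 * M) / δ)) hd' ?_ hw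
      · rwa [dslope_same] at this
      · intro x hx
        rw [mem_closedBall, dist_eq_norm]
        have := norm_sub_le (dslope (fun w => v w t) z x) (dslope (fun w => v w t) z z)
        linarith [hds x hx, hds z (mem_ball_self hδ)]
    have hlim : TendstoUniformlyOn (fun w t => dslope (fun w => v w t) z w)
        (fun t => _root_.deriv (fun w => v w t) z) (𝓝[≠] z) V := by
      rw [Metric.tendstoUniformlyOn_iff]
      intro ε hε
      have hc : Tendsto (fun w => (2 * ((2 * M) / δ)) / δ * dist w z) (𝓝[≠] z) (𝓝 0) := by
        have : Continuous (fun w => (2 * ((2 * M) / δ)) / δ * dist w z) := by fun_prop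
        have h := (this.tendsto z).mono_left (nhdsWithin_le_nhds (s := {z}ᶜ))
        simpa using h
      filter_upwards [hc.eventually_lt_const hε,
        mem_nhdsWithin_of_mem_nhds (ball_mem_nhds z hδ)] with w hw1 hw2 t ht
      rw [dist_comm]
      exact (herr t ht w hw2).trans_lt hw1
    refine hlim.tendstoLocallyUniformlyOn.differentiableOn ?_ hV
    filter_upwards [self_mem_nhdsWithin,
      mem_nhdsWithin_of_mem_nhds (ball_mem_nhds z hδ)] with w hw hw2
    have hne : w ≠ z := hw
    simp only [dslope_of_ne _ hne, slope, vsub_eq_sub]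
    exact ((h2 w (hsub hw2)).sub (h2 z hz)).const_mul ((w - z)⁻¹)
  · obtain ⟨δ, hδ, M, hsub, hM⟩ := h3 z hz
    refine ⟨δ / 2, by positivity, M / (δ / 4), (ball_subset_ball (by linarith)).trans hsub, ?_⟩
    intro w hw t ht
    have hcb : closedBall w (δ / 4) ⊆ ball z δ := by
      intro x hx
      rw [mem_closedBall] at hx
      rw [mem_ball] at hw ⊢
      have := dist_triangle x w z
      linarith
    apply Complex.norm_deriv_le_of_forall_mem_sphere_norm_le (by positivity)
    · exact (DifferentiableOn.mono (h1 t ht) (closure_ball_subset_closedBall.trans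
        (hcb.trans hsub))).diffContOnCl
    · intro x hx
      exact hM x (hcb (sphere_subset_closedBall hx)) t ht

lemma SepHol.iteratedDeriv {U V : Set ℂ} {v : ℂ → ℂ → ℂ} (hU : IsOpen U) (hV : IsOpen V)
    (h : SepHol U V v) (n : ℕ) : SepHol U V (fun z t => iteratedDeriv n (fun w => v w t) z) := by
  induction n with
  | zero => simpa using h
  | succ n ih =>
    have := ih.deriv hU hV
    simpa only [iteratedDeriv_succ] using this

/-- Baire category and the Hartogs lemma. -/
lemma hartogs_bdd {u : ℂ → ℂ → ℂ} {t0 : ℂ} {r : ℝ} (hr : 0 < r)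
    (h1 : ∀ t ∈ closedBall t0 r, Differentiable ℂ (fun w => u w t))
    (h2 : ∀ z, DifferentiableOn ℂ (u z) (closedBall t0 r)) (R : ℝ) :
    ∃ δ > 0, ∃ M, ∀ z ∈ ball (0 : ℂ) R, ∀ t ∈ ball t0 δ, ‖u z t‖ ≤ M := by
  -- Baire
  let F : ℕ → Set ℂ := fun M => {z | ∀ t ∈ closedBall t0 r, ‖u z t‖ ≤ M}
  have hFc : ∀ M, IsClosed (F M) := by
    intro M
    have : F M = ⋂ t ∈ closedBall t0 r, {z | ‖u z t‖ ≤ M} := by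
      ext z; simp [F]
    rw [this]
    exact isClosed_biInter fun t ht => isClosed_le (h1 t ht).continuous.norm continuous_const
  have hFu : ⋃ M, F M = univ := by
    rw [eq_univ_iff_forall]
    intro z
    obtain ⟨C, hC⟩ := (isCompact_closedBall t0 r).exists_bound_of_continuousOn (h2 z).continuousOn
    obtain ⟨M, hM⟩ := exists_nat_ge C
    exact mem_iUnion.2 ⟨M, fun t ht => (hC t ht).trans hM⟩
  obtain ⟨M0, z0, hz0⟩ := nonempty_interior_of_iUnion_of_closed hFc hFu
  obtain ⟨e, he, hball⟩ := Metric.isOpen_iff.1 isOpen_interior z0 hz0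
  have hbd : ∀ z ∈ ball z0 e, ∀ t ∈ closedBall t0 r, ‖u z t‖ ≤ M0 := fun z hz =>
    interior_subset (hball hz)
  have hrsub : ball t0 r ⊆ closedBall t0 r := ball_subset_closedBall
  have hsep : SepHol (ball z0 e) (ball t0 r) u := by
    refine ⟨fun t ht => (h1 t (hrsub ht)).differentiableOn, fun z _ => (h2 z).mono hrsub, ?_⟩
    intro z hz
    obtain ⟨d, hd, hsub⟩ := Metric.isOpen_iff.1 isOpen_ball z hz
    exact ⟨d, hd, M0, hsub, fun w hw t ht => hbd w (hsub hw) t (hrsub ht)⟩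
  let a : ℕ → ℂ → ℂ := fun n t => iteratedDeriv n (fun w => u w t) z0 / (n.factorial : ℂ)
  have hest : ∀ n t, t ∈ ball t0 r → ∀ s > 0, ∀ C, (∀ z ∈ sphere z0 s, ‖u z t‖ ≤ C) →
      ‖a n t‖ ≤ C / s ^ n := by
    intro n t ht s hs C hC
    have := Complex.norm_iteratedDeriv_le_of_forall_mem_sphere_norm_le n hs
      (h1 t (hrsub ht)).diffContOnCl hC
    simp only [a, norm_div, Complex.norm_natCast]
    rw [div_le_iff₀ (by positivity)]
    refine this.trans (le_of_eq (by ring))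
  set M : ℝ := max 1 M0 with hMdef
  have hM1 : 1 ≤ M := le_max_left _ _
  have hρ : 4 * (r / 4) = r := by ring
  have hhl := hartogs_lemma (a := a) (t0 := t0) (ρ := r / 4) (M := M) (B := (e / 2)⁻¹)
    (by positivity) hM1 (by positivity) ?_ ?_ ?_
  rotate_left
  · intro n
    rw [hρ]
    exact ((hsep.iteratedDeriv isOpen_ball isOpen_ball n).2.1 z0 (mem_ball_self he)).div_const _
  · intro n t ht
    rw [hρ] at ht
    have := hest n t ht (e / 2) (by positivity) M ?_
    · rwa [inv_pow, ← div_eq_mul_inv]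
    · intro z hz
      refine (hbd z ?_ t (hrsub ht)).trans (le_max_right _ _)
      rw [mem_sphere] at hz
      rw [mem_ball, hz]; linarith
  · intro t ht ε hε
    rw [hρ] at ht
    obtain ⟨C, hC⟩ := (isCompact_sphere z0 (2 / ε)).exists_bound_of_continuousOn
      (h1 t (hrsub ht)).continuous.continuousOn
    obtain ⟨N, hN⟩ := pow_unbounded_of_one_lt C (one_lt_two)
    refine ⟨N, fun n hn => ?_⟩
    refine (hest n t ht (2 / ε) (by positivity) C hC).trans ?_
    rw [div_pow, div_div_eq_mul_div, div_le_iff₀ (by positivity), mul_comm]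
    have : C ≤ 2 ^ n := hN.le.trans (pow_le_pow_right₀ one_le_two hn)
    gcongr
  -- conclude
  set L : ℝ := |R| + ‖z0‖ + 1 with hL
  have hLp : 0 < L := by positivity
  obtain ⟨N, hN⟩ := hhl (1 / (2 * L)) (by positivity)
  set K : ℝ := ∑ n ∈ Finset.range N, M * (e / 2)⁻¹ ^ n * L ^ n with hK
  refine ⟨r / 4, by positivity, K + M * 2, fun z hz t ht => ?_⟩
  have htr : t ∈ ball t0 r := ball_subset_ball (by linarith) ht
  have hzL : ‖z - z0‖ ≤ L := by
    rw [mem_ball_zero_iff] at hz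
    have := norm_sub_le z z0
    linarith [le_abs_self R]
  have hs := Complex.hasSum_taylorSeries_of_entire (h1 t (hrsub htr)) z0 z
  have han : ∀ n, ‖a n t‖ ≤ M * (e / 2)⁻¹ ^ n := by
    intro n
    have := hest n t htr (e / 2) (by positivity) M ?_
    · rwa [inv_pow, ← div_eq_mul_inv]
    · intro z hz
      refine (hbd z ?_ t (hrsub htr)).trans (le_max_right _ _)
      rw [mem_sphere] at hz
      rw [mem_ball, hz]; linarith
  have hterm : ∀ n, ‖((n.factorial : ℂ)⁻¹ • (z - z0) ^ n • iteratedDeriv n (fun w => u w t) z0)‖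
      ≤ (if n ∈ Finset.range N then M * (e / 2)⁻¹ ^ n * L ^ n else 0) + M * (1 / 2) ^ n := by
    intro n
    have hEq : (n.factorial : ℂ)⁻¹ • (z - z0) ^ n • iteratedDeriv n (fun w => u w t) z0
        = a n t * (z - z0) ^ n := by simp only [a, smul_eq_mul]; ring
    rw [hEq, norm_mul, norm_pow]
    have hpw : ‖z - z0‖ ^ n ≤ L ^ n := by gcongr
    split_ifs with hn
    · have : ‖a n t‖ * ‖z - z0‖ ^ n ≤ M * (e / 2)⁻¹ ^ n * L ^ n := by gcongr; exact han n
      have h0 : 0 ≤ M * (1 / 2) ^ n := by positivity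
      linarith
    · rw [Finset.mem_range, not_lt] at hn
      have h3 := hN n hn t ht
      rw [zero_add]
      calc ‖a n t‖ * ‖z - z0‖ ^ n ≤ M * (1 / (2 * L)) ^ n * L ^ n := by gcongr
        _ = M * (1 / 2) ^ n := by
          rw [mul_assoc, ← mul_pow]; congr 2; field_simp
  have hsum2 : HasSum (fun n => (if n ∈ Finset.range N then M * (e / 2)⁻¹ ^ n * L ^ n else 0)
      + M * (1 / 2 : ℝ) ^ n) (K + M * 2) := by
    apply HasSum.add
    · rw [hK]
      have := hasSum_sum_of_ne_finset_zero (L := SummationFilter.unconditional ℕ)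
        (f := fun n => if n ∈ Finset.range N then
        M * (e / 2)⁻¹ ^ n * L ^ n else 0) (s := Finset.range N) (by intro n hn; simp only [if_neg hn])
      rwa [Finset.sum_congr rfl (fun n hn => if_pos hn)] at this
    · exact hasSum_geometric_two.mul_left M
  rw [← hs.tsum_eq]
  exact tsum_of_norm_bounded hsum2 hterm

lemma SepHol.continuousAt {U V : Set ℂ} {v : ℂ → ℂ → ℂ} (hV : IsOpen V)
    (h : SepHol U V v) {z t : ℂ} (hz : z ∈ U) (ht : t ∈ V) :
    ContinuousAt (fun p : ℂ × ℂ => v p.1 p.2) (z, t) := by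
  obtain ⟨h1, h2, h3⟩ := h
  obtain ⟨δ, hδ, M, hsub, hM⟩ := h3 z hz
  have hkey : ∀ w ∈ ball z δ, ∀ s ∈ V, dist (v w s) (v z s) ≤ (2 * M) / δ * dist w z := by
    intro w hw s hs
    refine Complex.dist_le_div_mul_dist_of_mapsTo_ball (f := fun w => v w s)
      ((h1 s hs).mono hsub) ?_ hw
    intro x hx
    rw [mem_closedBall, dist_eq_norm]
    have := norm_sub_le (v x s) (v z s)
    linarith [hM x hx s hs, hM z (mem_ball_self hδ) s hs]
  have hvc : ContinuousAt (v z) t := ((h2 z hz).differentiableAt (hV.mem_nhds ht)).continuousAt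
  have hlim : Tendsto (fun p : ℂ × ℂ => (2 * M) / δ * dist p.1 z + dist (v z p.2) (v z t))
      (𝓝 (z, t)) (𝓝 0) := by
    have e1 : ContinuousAt (fun p : ℂ × ℂ => v z p.2) (z, t) :=
      ContinuousAt.comp (g := v z) (f := Prod.snd) hvc continuousAt_snd
    have e2 : ContinuousAt (fun p : ℂ × ℂ => (2 * M) / δ * dist p.1 z + dist (v z p.2) (v z t))
      (z, t) := by
      apply ContinuousAt.add
      · fun_prop
      · exact e1.dist continuousAt_const
    simpa [ContinuousAt] using e2
  rw [ContinuousAt, tendsto_iff_dist_tendsto_zero]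
  refine squeeze_zero' (Eventually.of_forall fun _ => dist_nonneg) ?_ hlim
  have hn : ball z δ ×ˢ V ∈ 𝓝 (z, t) := prod_mem_nhds (ball_mem_nhds z hδ) (hV.mem_nhds ht)
  filter_upwards [hn] with p hp
  exact (dist_triangle _ (v z p.2) _).trans (by gcongr; exact hkey p.1 hp.1 p.2 hp.2)

/-- Hartogs: a separately holomorphic function on `ℂ × ℍ` obeys the chain rule. -/
lemma hartogs_chain {u : ℂ → ℂ → ℂ}
    (hol : ∀ z τ : ℂ, 0 < τ.im →
      DifferentiableAt ℂ (fun w => u w τ) z ∧ DifferentiableAt ℂ (fun t => u z t) τ)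
    {f g : ℂ → ℂ} {f' g' x : ℂ} (hf : HasDerivAt f f' x) (hg : HasDerivAt g g' x)
    (hx : 0 < (g x).im) :
    HasDerivAt (fun t => u (f t) (g t))
      (deriv (fun w => u w (g x)) (f x) * f' + deriv (fun t => u (f x) t) (g x) * g') x := by
  set z := f x with hz
  set τ := g x with hτ
  have hopen : IsOpen {t : ℂ | 0 < t.im} := isOpen_lt continuous_const Complex.continuous_im
  obtain ⟨r0, hr0, hsub0⟩ := Metric.isOpen_iff.1 hopen τ hx
  have hcb : ∀ t ∈ closedBall τ (r0 / 2), 0 < t.im := fun t ht =>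
    hsub0 (closedBall_subset_ball (by linarith) ht)
  obtain ⟨d, hd, M, hM⟩ := hartogs_bdd (u := u) (t0 := τ) (r := r0 / 2) (by positivity)
    (fun t ht w => (hol w t (hcb t ht)).1)
    (fun z t ht => (hol z t (hcb t ht)).2.differentiableWithinAt) (‖z‖ + 1)
  set U := ball (0 : ℂ) (‖z‖ + 1) with hU
  set V := ball τ (min d (r0 / 2)) with hV
  have hUo : IsOpen U := isOpen_ball
  have hVo : IsOpen V := isOpen_ball
  have hVim : ∀ t ∈ V, 0 < t.im := fun t ht =>
    hcb t (ball_subset_closedBall (ball_subset_ball (min_le_right _ _) ht))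
  have hMV : ∀ z ∈ U, ∀ t ∈ V, ‖u z t‖ ≤ M := fun z hz t ht =>
    hM z hz t (ball_subset_ball (min_le_left _ _) ht)
  have hzU : z ∈ U := by simp [hU]
  have hτV : τ ∈ V := mem_ball_self (by positivity)
  have hs1 : SepHol U V u := by
    refine ⟨fun t ht w _ => (hol w t (hVim t ht)).1.differentiableWithinAt,
      fun z _ t ht => (hol z t (hVim t ht)).2.differentiableWithinAt, fun w hw => ?_⟩
    obtain ⟨δ, hδ, hs⟩ := Metric.isOpen_iff.1 hUo w hw
    exact ⟨δ, hδ, M, hs, fun w hw t ht => hMV w (hs hw) t ht⟩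
  have hs2 : SepHol V U (fun t w => u w t) := by
    refine ⟨fun z _ t ht => (hol z t (hVim t ht)).2.differentiableWithinAt,
      fun t ht w _ => (hol w t (hVim t ht)).1.differentiableWithinAt, fun t ht => ?_⟩
    obtain ⟨δ, hδ, hs⟩ := Metric.isOpen_iff.1 hVo t ht
    exact ⟨δ, hδ, M, hs, fun t ht w hw => hMV w hw t (hs ht)⟩
  have c1 := (hs1.deriv hUo hVo).continuousAt hVo hzU hτV
  have c2' := (hs2.deriv hVo hUo).continuousAt hUo hτV hzU
  have c2 : ContinuousAt (fun p : ℂ × ℂ => deriv (fun t => u p.1 t) p.2) (z, τ) :=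
    ContinuousAt.comp (f := Prod.swap) (x := (z, τ))
      (g := fun p : ℂ × ℂ => deriv (fun t => u p.2 t) p.1) c2' continuous_swap.continuousAt
  have hnb : U ×ˢ V ∈ 𝓝 (z, τ) := prod_mem_nhds (hUo.mem_nhds hzU) (hVo.mem_nhds hτV)
  have key := hasStrictFDerivAt_uncurry_coprod (𝕜 := ℂ) (f := u) (u := (z, τ))
    (f₁ := fun w t => ContinuousLinearMap.toSpanSingleton ℂ (deriv (fun w => u w t) w))
    (f₂ := fun w t => ContinuousLinearMap.toSpanSingleton ℂ (deriv (fun t => u w t) t))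
    ?_ ?_ ?_ ?_
  · have h3 := key.hasFDerivAt.comp_hasDerivAt x (hf.prodMk hg)
    refine HasDerivAt.congr_deriv h3 ?_
    change f' * deriv (fun w => u w τ) z + g' * deriv (fun t => u z t) τ = _
    ring
  · filter_upwards [hnb] with p hp
    exact (hol p.1 p.2 (hVim _ hp.2)).1.hasDerivAt.hasFDerivAt
  · filter_upwards [hnb] with p hp
    exact (hol p.1 p.2 (hVim _ hp.2)).2.hasDerivAt.hasFDerivAt
  · exact (ContinuousLinearMap.toSpanSingletonCLE (𝕜 := ℂ) (E := ℂ)).continuous.continuousAt.comp c1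
  · exact (ContinuousLinearMap.toSpanSingletonCLE (𝕜 := ℂ) (E := ℂ)).continuous.continuousAt.comp c2

end Hartogs

/-- The transformation
`S : u(λ,τ) ↦ e^{-πiκλ²/(2τ)} τ^{-1/2-p(p+1)/κ} u(λ/τ,-1/τ)` (with the principal
branch of the complex power, which on `ℍ` has `arg τ ∈ (0,π)`) preserves the set of
solutions of the KZB heat equation (among functions holomorphic in each variable
on `ℂ×ℍ`). -/
theorem KZB_S_invariant (κ p : ℕ) (hκ : 0 < κ) (u : ℂ → ℂ → ℂ)
    (hol : ∀ z τ : ℂ, 0 < τ.im →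
      DifferentiableAt ℂ (fun w => u w τ) z ∧ DifferentiableAt ℂ (fun t => u z t) τ)
    (hu : ∀ z τ : ℂ, 0 < τ.im → JTheta1 z τ ≠ 0 → KZB κ p u z τ) :
    ∀ z τ : ℂ, 0 < τ.im → JTheta1 z τ ≠ 0 →
      KZB κ p (fun w t => exp (-(cπ * I * (κ : ℂ) * w ^ 2 / (2 * t))) *
        t ^ (-(1 / 2 : ℂ) - (p : ℂ) * ((p : ℂ) + 1) / (κ : ℂ)) * u (w / t) (-1 / t)) z τ := by
  intro z τ hτ hz
  have hτ0 : τ ≠ 0 := by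
    rintro rfl
    simp at hτ
  have hκ0 : (κ : ℂ) ≠ 0 := by exact_mod_cast hκ.ne'
  obtain ⟨hz', hrho⟩ := Rho'_S hτ hz
  have hs := S_im_pos hτ
  have hK := hu _ _ hs hz'
  have hslit : τ ∈ slitPlane := Or.inr hτ.ne'
  unfold KZB at hK ⊢
  set b : ℂ := -(1 / 2 : ℂ) - (p : ℂ) * ((p : ℂ) + 1) / (κ : ℂ) with hb
  set s : ℂ := -1 / τ with hsdef
  have hent : Differentiable ℂ (fun w => u w s) := fun w => (hol w s hs).1
  have hent' : Differentiable ℂ (deriv (fun w => u w s)) := hent.deriv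
  -- time derivative
  have hfd : HasDerivAt (fun t : ℂ => z / t) (-z / τ ^ 2) τ := by
    have := (hasDerivAt_const τ z).div (hasDerivAt_id τ) hτ0
    refine HasDerivAt.congr_deriv this ?_
    simp
  have hgd : HasDerivAt (fun t : ℂ => -1 / t) (1 / τ ^ 2) τ := by
    have := (hasDerivAt_const τ (-1 : ℂ)).div (hasDerivAt_id τ) hτ0
    refine HasDerivAt.congr_deriv this ?_
    simp
  have hch := hartogs_chain hol hfd hgd hs
  have hE : HasDerivAt (fun t : ℂ => exp (-(cπ * I * (κ : ℂ) * z ^ 2 / (2 * t))))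
      (exp (-(cπ * I * (κ : ℂ) * z ^ 2 / (2 * τ))) * (cπ * I * (κ : ℂ) * z ^ 2 / (2 * τ ^ 2))) τ := by
    apply HasDerivAt.cexp
    have := ((hasDerivAt_const τ (cπ * I * (κ : ℂ) * z ^ 2)).div
      ((hasDerivAt_id τ).const_mul 2) (by simpa using hτ0)).neg
    refine HasDerivAt.congr_deriv this ?_
    simp
    field_simp
  have hP : HasDerivAt (fun t : ℂ => t ^ b) (b * τ ^ b / τ) τ := by
    have := (hasDerivAt_id τ).cpow_const (c := b) hslit
    refine HasDerivAt.congr_deriv this ?_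
    simp only [id, mul_one]
    rw [cpow_sub b 1 hτ0, cpow_one]
    ring
  have hT := ((hE.mul hP).mul hch).deriv
  have hT' : deriv (fun t => exp (-(cπ * I * (κ : ℂ) * z ^ 2 / (2 * t))) * t ^ b *
      u (z / t) (-1 / t)) τ = _ := hT
  -- space derivatives
  have hEz : ∀ w : ℂ, HasDerivAt (fun w : ℂ => exp (-(cπ * I * (κ : ℂ) * w ^ 2 / (2 * τ))))
      (exp (-(cπ * I * (κ : ℂ) * w ^ 2 / (2 * τ))) * (-(cπ * I * (κ : ℂ) * w / τ))) w := by
    intro w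
    apply HasDerivAt.cexp
    have := ((((hasDerivAt_id w).pow 2).const_mul (cπ * I * (κ : ℂ))).div_const (2 * τ)).neg
    refine HasDerivAt.congr_deriv this ?_
    simp
    field_simp
  have hdz : ∀ w : ℂ, HasDerivAt (fun w : ℂ => w / τ) (1 / τ) w := fun w =>
    (hasDerivAt_id w).div_const τ
  have hU : ∀ w : ℂ, HasDerivAt (fun w : ℂ => u (w / τ) s)
      (deriv (fun w => u w s) (w / τ) * (1 / τ)) w := fun w =>
    HasDerivAt.comp (h₂ := fun w => u w s) w (hent (w / τ)).hasDerivAt (hdz w)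
  have hU' : ∀ w : ℂ, HasDerivAt (fun w : ℂ => deriv (fun w => u w s) (w / τ))
      (deriv (deriv (fun w => u w s)) (w / τ) * (1 / τ)) w := fun w =>
    HasDerivAt.comp (h₂ := deriv (fun w => u w s)) w (hent' (w / τ)).hasDerivAt (hdz w)
  have hD1 : deriv (fun w => exp (-(cπ * I * (κ : ℂ) * w ^ 2 / (2 * τ))) * τ ^ b * u (w / τ) s) =
      fun w => exp (-(cπ * I * (κ : ℂ) * w ^ 2 / (2 * τ))) * (τ ^ b *
        (-(cπ * I * (κ : ℂ) * w / τ) * u (w / τ) s + deriv (fun w => u w s) (w / τ) * (1 / τ))) := by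
    funext w
    have := (((hEz w).mul_const (τ ^ b)).mul (hU w)).deriv
    refine Eq.trans this ?_
    ring
  have hlin : HasDerivAt (fun w : ℂ => -(cπ * I * (κ : ℂ) * w / τ)) (-(cπ * I * (κ : ℂ) / τ)) z := by
    have := (((hasDerivAt_id z).const_mul (cπ * I * (κ : ℂ))).div_const τ).neg
    refine HasDerivAt.congr_deriv this ?_
    simp
  have hD2d := ((hEz z).mul (((hlin.mul (hU z)).add ((hU' z).mul_const (1 / τ))).const_mul
      (τ ^ b))).deriv
  have hD2e : iteratedDeriv 2 (fun w => exp (-(cπ * I * (κ : ℂ) * w ^ 2 / (2 * τ))) * τ ^ b *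
      u (w / τ) s) z = deriv (fun w => exp (-(cπ * I * (κ : ℂ) * w ^ 2 / (2 * τ))) * (τ ^ b *
        (-(cπ * I * (κ : ℂ) * w / τ) * u (w / τ) s +
          deriv (fun w => u w s) (w / τ) * (1 / τ)))) z := by
    rw [iteratedDeriv_succ, iteratedDeriv_one, hD1]
  have hD2 := hD2e.trans hD2d
  rw [iteratedDeriv_succ, iteratedDeriv_one] at hK
  beta_reduce
  rw [hT', hD2]
  simp only [Pi.mul_apply, Pi.add_apply]
  rw [hrho] at hK
  rw [← hsdef]
  set E := exp (-(cπ * I * (κ : ℂ) * z ^ 2 / (2 * τ)))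
  set P := τ ^ b
  set ut := deriv (fun t => u (z / τ) t) s
  set uz := deriv (fun w => u w s) (z / τ)
  set uzz := deriv (deriv (fun w => u w s)) (z / τ)
  set u0 := u (z / τ) s
  have hzz : uzz = 2 * cπ * I * (κ : ℂ) * ut - (p : ℂ) * ((p : ℂ) + 1) *
      (2 * cπ * I * τ + τ ^ 2 * Rho' z τ) * u0 := by rw [hK]; ring
  rw [hzz, hb]
  field_simp
  ring_nf
end

section
/- Let κ be a positive integer, p a nonnegative integer, and let u : ℂ×ℍ → ℂ satisfy u(−λ,τ) = (−1)^{p+1} u(λ,τ) for all (λ,τ) ∈ ℂ×ℍ. Define Su(λ,τ) = e^{−πiκλ²/(2τ)} τ^{−1/2 − p(p+1)/κ} u(λ/τ, −1/τ), where the complex power τ^w is taken with arg τ ∈ (0,π) (principal branch on ℍ). Then S(Su)(λ,τ) = (−1)^p · i · e^{−πi p(p+1)/κ} · u(λ,τ) for all (λ,τ) ∈ ℂ×ℍ. -/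
open Complex

/-- The transformation `S : u(λ,τ) ↦ e^{-πiκλ²/(2τ)} τ^{-1/2-p(p+1)/κ} u(λ/τ,-1/τ)`,
with the principal branch of the complex power `τ ^ w` (on `ℍ`, `arg τ ∈ (0,π)`). -/
noncomputable def STrans (κ p : ℕ) (u : ℂ → ℂ → ℂ) : ℂ → ℂ → ℂ :=
  fun z τ => exp (-(cπ * I * (κ : ℂ) * z ^ 2 / (2 * τ))) *
    τ ^ (-(1 / 2 : ℂ) - (p : ℂ) * ((p : ℂ) + 1) / (κ : ℂ)) * u (z / τ) (-1 / τ)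

/-- If `u(-λ,τ) = (-1)^{p+1} u(λ,τ)` on `ℂ×ℍ`, then
`S(Su)(λ,τ) = (-1)^p i e^{-πip(p+1)/κ} u(λ,τ)` on `ℂ×ℍ`. -/
theorem STrans_sq (κ p : ℕ) (hκ : 0 < κ) (u : ℂ → ℂ → ℂ)
    (hu : ∀ z τ : ℂ, 0 < τ.im → u (-z) τ = (-1 : ℂ) ^ (p + 1) * u z τ) :
    ∀ z τ : ℂ, 0 < τ.im →
      STrans κ p (STrans κ p u) z τ =
        (-1 : ℂ) ^ p * I * exp (-(cπ * I * (p : ℂ) * ((p : ℂ) + 1) / (κ : ℂ))) * u z τ := by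
  intro z τ hτ
  have h0 : τ ≠ 0 := by
    rintro rfl
    simp at hτ
  have hargpi : τ.arg ≠ Real.pi := by
    intro h
    rw [Complex.arg_eq_pi_iff] at h
    exact hτ.ne' h.2
  have him : (τ⁻¹).im < 0 := by
    rw [Complex.inv_im]
    exact div_neg_of_neg_of_pos (neg_lt_zero.mpr hτ) (Complex.normSq_pos.mpr h0)
  have hlog : log (-1 / τ) = Real.pi * I - log τ := by
    have e : -1 / τ = -τ⁻¹ := by field_simp
    rw [e, Complex.log, norm_neg, Complex.arg_neg_eq_arg_add_pi_of_im_neg him]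
    have h2 := Complex.log_inv τ hargpi
    rw [Complex.log] at h2
    push_cast
    linear_combination h2
  have h1 : (-1 / τ) ≠ 0 := div_ne_zero (by simp) h0
  have e1 : z / τ / (-1 / τ) = -z := by field_simp
  have e2 : -1 / (-1 / τ) = τ := by field_simp
  have hk : (κ : ℂ) ≠ 0 := by exact_mod_cast hκ.ne'
  have hI : exp (-(Real.pi / 2 * I)) = -I := by
    rw [Complex.exp_neg, Complex.exp_pi_div_two_mul_I, Complex.inv_I]
  unfold STrans
  rw [e1, e2, hu z τ hτ, Complex.cpow_def_of_ne_zero h0, Complex.cpow_def_of_ne_zero h1, hlog]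
  have key : exp (-(cπ * I * (κ : ℂ) * z ^ 2 / (2 * τ))) *
      exp (log τ * (-(1 / 2 : ℂ) - (p : ℂ) * ((p : ℂ) + 1) / (κ : ℂ))) *
      (exp (-(cπ * I * (κ : ℂ) * (z / τ) ^ 2 / (2 * (-1 / τ)))) *
      exp ((Real.pi * I - log τ) * (-(1 / 2 : ℂ) - (p : ℂ) * ((p : ℂ) + 1) / (κ : ℂ))))
      = -I * exp (-(cπ * I * (p : ℂ) * ((p : ℂ) + 1) / (κ : ℂ))) := by
    rw [← hI, ← Complex.exp_add, ← Complex.exp_add, ← Complex.exp_add, ← Complex.exp_add]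
    congr 1
    unfold cπ
    field_simp
    ring
  rw [pow_succ (-1 : ℂ) p]
  linear_combination ((-1 : ℂ) ^ p * (-1) * u z τ) * key
end

section
/- For every τ in the upper half-plane: (θ_{4,1}(0,τ) − θ_{4,3}(0,τ))/η(τ) = φ₁(τ)^{−1}, (θ_{4,1}(0,τ) + θ_{4,3}(0,τ))/η(τ) = φ₂(τ)^{−1}, and (θ_{4,0}(0,τ) − θ_{4,4}(0,τ))/(√2 η(τ)) = φ₃(τ)^{−1}. -/
open Complex

/-- `φ₁(τ) = η(τ)²/(η(τ/2)η(2τ))`. -/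
noncomputable def Phi1 (τ : ℂ) : ℂ := DEta τ ^ 2 / (DEta (τ / 2) * DEta (2 * τ))

/-- `φ₂(τ) = η(τ/2)/η(τ)`. -/
noncomputable def Phi2 (τ : ℂ) : ℂ := DEta (τ / 2) / DEta τ

/-- `φ₃(τ) = √2 η(2τ)/η(τ)`. -/
noncomputable def Phi3 (τ : ℂ) : ℂ := (Real.sqrt 2 : ℂ) * DEta (2 * τ) / DEta τ

open Filter Topology

/-- Euler product. -/
noncomputable def EE (q : ℂ) : ℂ := ∏' n : ℕ, (1 - q ^ (n + 1))

/-- Partial Euler product. -/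
noncomputable def PP (q : ℂ) (n : ℕ) : ℂ := ∏ i ∈ Finset.range n, (1 - q ^ (i + 1))

/-- Reciprocal partial Euler product, extended by zero to negative integers. -/
noncomputable def RR (q : ℂ) (k : ℤ) : ℂ := if k < 0 then 0 else (PP q k.toNat)⁻¹

lemma one_sub_pow_ne {q : ℂ} (hq : ‖q‖ < 1) (n : ℕ) : 1 - q ^ (n + 1) ≠ 0 := by
  intro h
  have h1 : q ^ (n + 1) = 1 := (sub_eq_zero.mp h).symm
  have h2 : ‖q‖ ^ (n + 1) = 1 := by rw [← norm_pow, h1, norm_one]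
  have h3 : ‖q‖ ^ (n + 1) < 1 := pow_lt_one₀ (norm_nonneg _) hq (by omega)
  linarith

lemma PP_ne {q : ℂ} (hq : ‖q‖ < 1) (n : ℕ) : PP q n ≠ 0 :=
  Finset.prod_ne_zero_iff.mpr fun i _ => one_sub_pow_ne hq i

lemma EE_ne {q : ℂ} (hq : ‖q‖ < 1) : EE q ≠ 0 := by
  refine tprod_one_add_ne_zero_of_summable (f := fun n : ℕ => -q ^ (n + 1)) ?_ ?_
  · intro i
    simpa [sub_eq_add_neg] using one_sub_pow_ne hq i
  · simpa using (summable_nat_add_iff 1).mpr (summable_geometric_of_lt_one (norm_nonneg _) hq)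

lemma PP_tendsto {q : ℂ} (hq : ‖q‖ < 1) : Tendsto (PP q) atTop (𝓝 (EE q)) :=
  (ModularForm.multipliable_one_sub_pow hq).tendsto_prod_tprod_nat

lemma RR_rec {q : ℂ} (hq : ‖q‖ < 1) (k : ℤ) : RR q (k - 1) = (1 - q ^ k) * RR q k := by
  rcases lt_trichotomy k 0 with h | h | h
  · simp [RR, h, show k - 1 < 0 by omega]
  · subst h; simp [RR]
  · obtain ⟨n, rfl⟩ : ∃ n : ℕ, k = n + 1 := ⟨(k - 1).toNat, by omega⟩
    have h1 : ¬ ((n : ℤ) + 1 < 0) := by omega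
    have h2 : ((n : ℤ) + 1).toNat = n + 1 := by omega
    have h3 : ((n : ℤ) + 1 - 1) = n := by omega
    rw [h3]
    simp only [RR, h1, h2, if_false, Int.toNat_natCast, show ¬ ((n : ℤ) < 0) by omega]
    have h4 : PP q (n + 1) = PP q n * (1 - q ^ (n + 1)) := Finset.prod_range_succ _ _
    have h5 := one_sub_pow_ne hq n
    have h6 := PP_ne hq n
    have h7 : q ^ ((n : ℤ) + 1) = q ^ (n + 1) := by exact_mod_cast zpow_natCast q (n + 1)
    rw [h4, h7]
    field_simp

lemma RR_bdd {q : ℂ} (hq : ‖q‖ < 1) : ∃ C : ℝ, 0 ≤ C ∧ ∀ k, ‖RR q k‖ ≤ C := by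
  have h : Tendsto (fun n => (PP q n)⁻¹) atTop (𝓝 (EE q)⁻¹) := (PP_tendsto hq).inv₀ (EE_ne hq)
  obtain ⟨C, hC⟩ := h.norm.bddAbove_range
  have hC' : ∀ n, ‖(PP q n)⁻¹‖ ≤ C := fun n => hC ⟨n, rfl⟩
  have h0 : 0 ≤ C := (norm_nonneg _).trans (hC' 0)
  refine ⟨C, h0, fun k => ?_⟩
  unfold RR
  split_ifs
  · simpa using h0
  · exact hC' _

lemma RR_tendsto {q : ℂ} (hq : ‖q‖ < 1) (f : ℕ → ℤ) (hf : Tendsto f atTop atTop) :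
    Tendsto (fun n => RR q (f n)) atTop (𝓝 (EE q)⁻¹) := by
  have h : Tendsto (fun n => (PP q n)⁻¹) atTop (𝓝 (EE q)⁻¹) := (PP_tendsto hq).inv₀ (EE_ne hq)
  have h1 : Tendsto (fun n => (f n).toNat) atTop atTop := by
    rw [tendsto_atTop] at hf ⊢
    intro b
    filter_upwards [hf b] with n hn
    omega
  refine (h.comp h1).congr' ?_
  filter_upwards [hf.eventually_ge_atTop 0] with n hn
  simp [RR, not_lt.mpr hn]

lemma fin_jtp {Q x : ℂ} (hQ0 : Q ≠ 0) (hQ : ‖Q‖ < 1) (hx : x ≠ 0) (w : ℤ → ℂ)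
    (hw : ∀ j, w (j + 1) = x * Q ^ j * w j) (N M : ℕ) :
    HasSum (fun j : ℤ => PP Q (N + M) * RR Q (M + j) * RR Q (N - j) * w j)
      (w 0 * (∏ k ∈ Finset.range N, (1 + x * Q ^ k)) *
        ∏ k ∈ Finset.range M, (1 + Q ^ (k + 1) / x)) := by
  have stepM : ∀ N M : ℕ, ∀ S : ℂ,
      HasSum (fun j : ℤ => PP Q (N + M) * RR Q (M + j) * RR Q (N - j) * w j) S →
      HasSum (fun j : ℤ => PP Q (N + (M + 1)) * RR Q ((M + 1 : ℕ) + j) * RR Q (N - j) * w j)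
        (S * (1 + Q ^ (M + 1) / x)) := by
    intro N M S h
    have h1 := ((Equiv.addRight (1 : ℤ)).hasSum_iff).mpr h
    have h2 := h.add (h1.mul_right (Q ^ (M + 1) / x))
    rw [show S * (1 + Q ^ (M + 1) / x) = S + S * (Q ^ (M + 1) / x) by ring]
    refine h2.congr_fun ?_
    intro j
    have e1 := RR_rec hQ ((M : ℤ) + 1 + j)
    have e2 := RR_rec hQ ((N : ℤ) - j)
    rw [show (M : ℤ) + 1 + j - 1 = M + j by ring] at e1
    have e3 : PP Q (N + (M + 1)) = PP Q (N + M) * (1 - Q ^ (N + M + 1)) :=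
      Finset.prod_range_succ _ _
    have e4 : Q ^ (N + M + 1) = Q ^ ((M : ℤ) + 1 + j) * Q ^ ((N : ℤ) - j) := by
      rw [← zpow_add₀ hQ0, ← zpow_natCast]; congr 1; push_cast; ring
    have e5 : Q ^ (M + 1) * Q ^ j = Q ^ ((M : ℤ) + 1 + j) := by
      rw [zpow_add₀ hQ0, ← zpow_natCast]; push_cast; rfl
    simp only [Function.comp, Equiv.coe_addRight, hw]
    rw [show (M : ℤ) + (j + 1) = M + 1 + j by ring, show (N : ℤ) - (j + 1) = N - j - 1 by ring,
      e1, e2, e3, e4]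
    push_cast
    rw [← e5]
    field_simp
    ring
  have stepN : ∀ N M : ℕ, ∀ S : ℂ,
      HasSum (fun j : ℤ => PP Q (N + M) * RR Q (M + j) * RR Q (N - j) * w j) S →
      HasSum (fun j : ℤ => PP Q (N + 1 + M) * RR Q (M + j) * RR Q ((N + 1 : ℕ) - j) * w j)
        (S * (1 + x * Q ^ N)) := by
    intro N M S h
    have h1 := ((Equiv.subRight (1 : ℤ)).hasSum_iff).mpr h
    have h2 := h.add (h1.mul_right (x * Q ^ N))
    rw [show S * (1 + x * Q ^ N) = S + S * (x * Q ^ N) by ring]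
    refine h2.congr_fun ?_
    intro j
    have e1 := RR_rec hQ ((M : ℤ) + j)
    have e2 := RR_rec hQ ((N : ℤ) + 1 - j)
    rw [show (N : ℤ) + 1 - j - 1 = N - j by ring] at e2
    have e3 : PP Q (N + 1 + M) = PP Q (N + M) * (1 - Q ^ (N + M + 1)) := by
      rw [show N + 1 + M = (N + M) + 1 by ring]; exact Finset.prod_range_succ _ _
    have e4 : Q ^ (N + M + 1) = Q ^ ((M : ℤ) + j) * Q ^ ((N : ℤ) + 1 - j) := by
      rw [← zpow_add₀ hQ0, ← zpow_natCast]; congr 1; push_cast; ring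
    have e5 : Q ^ ((N : ℤ) + 1 - j) * Q ^ (j - 1) = Q ^ N := by
      rw [← zpow_add₀ hQ0, ← zpow_natCast]; congr 1; ring
    have e6 := hw (j - 1)
    rw [sub_add_cancel] at e6
    simp only [Function.comp, Equiv.subRight_apply]
    rw [show (M : ℤ) + (j - 1) = M + j - 1 by ring, show (N : ℤ) - (j - 1) = N + 1 - j by ring,
      e1, e2, e3, e4, e6]
    push_cast
    rw [← e5]
    ring
  induction N with
  | zero =>
    induction M with
    | zero =>
      have := hasSum_single (f := fun j : ℤ =>
        PP Q (0 + 0) * RR Q ((0 : ℕ) + j) * RR Q ((0 : ℕ) - j) * w j) 0 (by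
          intro j hj
          rcases lt_or_gt_of_ne hj with h | h
          · simp [RR, h]
          · simp [RR, h])
      simpa [PP, RR] using this
    | succ M ih =>
      rw [Finset.prod_range_succ, ← mul_assoc]
      exact stepM _ _ _ ih
  | succ N ih =>
    rw [Finset.prod_range_succ]
    have := stepN _ _ _ ih
    convert this using 1
    ring

lemma summable_w {Q x : ℂ} (hQ0 : Q ≠ 0) (hQ : ‖Q‖ < 1) (hx : x ≠ 0) (w : ℤ → ℂ)
    (hw : ∀ j, w (j + 1) = x * Q ^ j * w j) : Summable w := by
  by_cases h0 : w 0 = 0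
  · have : w = 0 := by
      ext j
      induction j using Int.induction_on with
      | zero => exact h0
      | succ i ih => simp_all
      | pred i ih =>
        have := hw (-i - 1)
        rw [sub_add_cancel, ih] at this
        have h2 : x * Q ^ (-(i : ℤ) - 1) ≠ 0 := mul_ne_zero hx (zpow_ne_zero _ hQ0)
        simpa [hx, zpow_ne_zero _ hQ0] using this
    rw [this]; exact summable_zero
  · have hne : ∀ j, w j ≠ 0 := by
      intro j
      induction j using Int.induction_on with
      | zero => exact h0
      | succ i ih => rw [hw]; exact mul_ne_zero (mul_ne_zero hx (zpow_ne_zero _ hQ0)) ih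
      | pred i ih =>
        intro h
        have := hw (-i - 1)
        rw [sub_add_cancel, h, mul_zero] at this
        exact ih this
    have hg : Tendsto (fun n : ℕ => ‖Q‖ ^ n) atTop (𝓝 0) :=
      tendsto_pow_atTop_nhds_zero_of_lt_one (norm_nonneg _) hQ
    apply Summable.of_nat_of_neg
    · refine summable_of_ratio_test_tendsto_lt_one (l := 0) one_pos (.of_forall fun n => hne _) ?_
      have : Tendsto (fun n : ℕ => ‖x‖ * ‖Q‖ ^ n) atTop (𝓝 0) := by simpa using hg.const_mul ‖x‖
      refine this.congr fun n => ?_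
      have h3 : ‖w n‖ ≠ 0 := norm_ne_zero_iff.mpr (hne _)
      push_cast
      rw [hw]
      simp [h3]
    · refine summable_of_ratio_test_tendsto_lt_one (l := 0) one_pos (.of_forall fun n => hne _) ?_
      have : Tendsto (fun n : ℕ => ‖x‖⁻¹ * ‖Q‖ * ‖Q‖ ^ n) atTop (𝓝 0) := by
        simpa using hg.const_mul (‖x‖⁻¹ * ‖Q‖)
      refine this.congr fun n => ?_
      have h4 := hw (-(n + 1 : ℕ))
      rw [show -((n + 1 : ℕ) : ℤ) + 1 = -n by push_cast; ring] at h4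
      have h3 : ‖w (-(n + 1 : ℕ))‖ ≠ 0 := norm_ne_zero_iff.mpr (hne _)
      have h5 : ‖Q‖ ≠ 0 := norm_ne_zero_iff.mpr hQ0
      have h6 : ‖x‖ ≠ 0 := norm_ne_zero_iff.mpr hx
      rw [h4, zpow_neg, zpow_natCast]
      simp only [norm_mul, norm_inv, norm_pow]
      field_simp
      ring

lemma mult_aux {Q : ℂ} (hQ : ‖Q‖ < 1) (c : ℂ) : Multipliable fun k : ℕ => 1 + c * Q ^ k := by
  apply multipliable_one_add_of_summable
  simpa using (summable_geometric_of_lt_one (norm_nonneg _) hQ).mul_left ‖c‖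

lemma jtp {Q x : ℂ} (hQ0 : Q ≠ 0) (hQ : ‖Q‖ < 1) (hx : x ≠ 0) (w : ℤ → ℂ)
    (hw : ∀ j, w (j + 1) = x * Q ^ j * w j) :
    HasSum w (w 0 * (EE Q * (∏' k : ℕ, (1 + x * Q ^ k)) * ∏' k : ℕ, (1 + Q / x * Q ^ k))) := by
  have hs := summable_w hQ0 hQ hx w hw
  obtain ⟨C, hC0, hC⟩ := RR_bdd hQ
  obtain ⟨D, hD⟩ := (PP_tendsto hQ).norm.bddAbove_range
  have hD' : ∀ n, ‖PP Q n‖ ≤ D := fun n => hD ⟨n, rfl⟩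
  have hE := EE_ne hQ
  have lim1 : Tendsto (fun n : ℕ => ∑' j : ℤ,
      PP Q (n + n) * RR Q (n + j) * RR Q (n - j) * w j) atTop
      (𝓝 (∑' j : ℤ, (EE Q)⁻¹ * w j)) := by
    refine tendsto_tsum_of_dominated_convergence (bound := fun j => D * C * C * ‖w j‖)
      (hs.norm.mul_left _) ?_ ?_
    · intro j
      have a1 : Tendsto (fun n : ℕ => PP Q (n + n)) atTop (𝓝 (EE Q)) :=
        (PP_tendsto hQ).comp (tendsto_id.atTop_add_atTop tendsto_id)
      have a2 := RR_tendsto hQ (fun n : ℕ => (n : ℤ) + j)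
        (tendsto_atTop_add_const_right _ _ tendsto_natCast_atTop_atTop)
      have a3 := RR_tendsto hQ (fun n : ℕ => (n : ℤ) - j)
        (tendsto_atTop_add_const_right _ _ tendsto_natCast_atTop_atTop)
      have := ((a1.mul a2).mul a3).mul_const (w j)
      rwa [mul_inv_cancel₀ hE, one_mul] at this
    · refine .of_forall fun n j => ?_
      simp only [norm_mul]
      have := hD' (n + n)
      have := hC (n + j)
      have := hC (n - j)
      have : 0 ≤ D := (norm_nonneg _).trans (hD' 0)
      gcongr
  have lim2 : Tendsto (fun n : ℕ => ∑' j : ℤ,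
      PP Q (n + n) * RR Q (n + j) * RR Q (n - j) * w j) atTop
      (𝓝 (w 0 * (∏' k : ℕ, (1 + x * Q ^ k)) * ∏' k : ℕ, (1 + Q / x * Q ^ k))) := by
    have := ((mult_aux hQ x).tendsto_prod_tprod_nat.const_mul (w 0)).mul
      (mult_aux hQ (Q / x)).tendsto_prod_tprod_nat
    refine this.congr fun n => ?_
    rw [(fin_jtp hQ0 hQ hx w hw n n).tsum_eq]
    congr 1
    refine Finset.prod_congr rfl fun k _ => ?_
    ring
  have key := tendsto_nhds_unique lim1 lim2
  rw [tsum_mul_left] at key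
  have : ∑' j, w j = w 0 * (EE Q * (∏' k : ℕ, (1 + x * Q ^ k)) * ∏' k : ℕ, (1 + Q / x * Q ^ k)) := by
    rw [inv_mul_eq_iff_eq_mul₀ hE] at key
    rw [key]; ring
  rw [← this]
  exact hs.hasSum

lemma tsum_int_even_odd {f : ℤ → ℂ} (hf : Summable f) :
    ∑' j, f j = ∑' j, f (2 * j) + ∑' j, f (2 * j + 1) := by
  have i1 : Function.Injective (fun j : ℤ => 2 * j) := fun a b h => by simpa using h
  have i2 : Function.Injective (fun j : ℤ => 2 * j + 1) := fun a b h => by simpa using h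
  have h1 := (hf.comp_injective i1).hasSum
  have h2 := (hf.comp_injective i2).hasSum
  have h1' := i1.hasSum_range_iff.mpr h1
  have h2' := i2.hasSum_range_iff.mpr h2
  refine (h1'.add_isCompl ?_ h2').tsum_eq
  have r1 : Set.range (fun j : ℤ => 2 * j) = {n | Even n} := by
    ext n; simp only [Set.mem_range, Set.mem_ofPred_eq, even_iff_exists_two_mul, eq_comm]
  have r2 : Set.range (fun j : ℤ => 2 * j + 1) = {n | Odd n} := by
    ext n; simp only [Set.mem_range, Set.mem_ofPred_eq, Odd, eq_comm]
  rw [r1, r2]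
  exact Int.isCompl_even_odd

lemma tprod_split {p : ℂ} (hp : ‖p‖ < 1) (s : ℂ) :
    (∏' k : ℕ, (1 + s * (p ^ 2) ^ k)) * (∏' k : ℕ, (1 + s * p * (p ^ 2) ^ k)) =
      ∏' k : ℕ, (1 + s * p ^ k) := by
  have hp2 : ‖p ^ 2‖ < 1 := by
    rw [norm_pow]; exact pow_lt_one₀ (norm_nonneg _) hp (by norm_num)
  rw [← tprod_even_mul_odd (f := fun k : ℕ => 1 + s * p ^ k)]
  · congr 1
    · congr 1; ext k; ring
    · congr 1; ext k; ring
  · convert mult_aux hp2 s using 2; ring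
  · convert mult_aux hp2 (s * p) using 2; ring

lemma EE_eq (p : ℂ) : EE p = ∏' k : ℕ, (1 + (-p) * p ^ k) := by
  unfold EE; congr 1; ext k; ring

lemma norm_exp_lt {τ : ℂ} (hτ : 0 < τ.im) : ‖exp (cπ * I * τ)‖ < 1 := by
  rw [Complex.norm_exp, Real.exp_lt_one_iff]
  have : (cπ * I * τ).re = -(Real.pi * τ.im) := by simp [cπ]
  rw [this]
  have := mul_pos Real.pi_pos hτ
  linarith

lemma theta_odd {τ : ℂ} (hτ : 0 < τ.im) (s : ℂ) (hs : s ^ 2 = 1) :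
    ThetaKN 4 1 0 τ + s * ThetaKN 4 3 0 τ =
      exp (cπ * I * τ / 8) * (EE (exp (cπ * I * τ) ^ 4) *
        ∏' k : ℕ, (1 + s * exp (cπ * I * τ) * (exp (cπ * I * τ) ^ 2) ^ k)) := by
  have hs0 : s ≠ 0 := by rintro rfl; norm_num at hs
  have hsi : s⁻¹ = s := inv_eq_of_mul_eq_one_right (by rw [← sq, hs])
  set p := exp (cπ * I * τ) with hpdef
  have hp0 : p ≠ 0 := exp_ne_zero _
  have hp : ‖p‖ < 1 := norm_exp_lt hτ
  have hp2 : ‖p ^ 2‖ < 1 := by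
    rw [norm_pow]; exact pow_lt_one₀ (norm_nonneg _) hp (by norm_num)
  have hp4 : ‖p ^ 4‖ < 1 := by
    rw [norm_pow]; exact pow_lt_one₀ (norm_nonneg _) hp (by norm_num)
  set w : ℤ → ℂ := fun m => s ^ m * exp (cπ * I * τ * (4 * m + 1) ^ 2 / 8) with hwdef
  have hw : ∀ j, w (j + 1) = (s * p ^ 3) * (p ^ 4) ^ j * w j := by
    intro j
    have e1 : (p ^ 4) ^ j = exp (cπ * I * τ * (4 * j)) := by
      rw [hpdef, ← exp_nat_mul, ← exp_int_mul]; congr 1; push_cast; ring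
    have e2 : p ^ 3 = exp (cπ * I * τ * 3) := by
      rw [hpdef, ← exp_nat_mul]; congr 1; push_cast; ring
    simp only [hwdef]
    rw [zpow_add_one₀ hs0, e1, e2]
    have : exp (cπ * I * τ * (4 * ((j + 1 : ℤ) : ℂ) + 1) ^ 2 / 8) =
        exp (cπ * I * τ * 3) * exp (cπ * I * τ * (4 * j)) *
          exp (cπ * I * τ * (4 * j + 1) ^ 2 / 8) := by
      rw [← exp_add, ← exp_add]; congr 1; push_cast; ring
    rw [this]; ring
  have h := jtp (pow_ne_zero 4 hp0) hp4 (mul_ne_zero hs0 (pow_ne_zero 3 hp0)) w hw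
  have h1 := tsum_int_even_odd h.summable
  rw [h.tsum_eq] at h1
  have t1 : ∑' j, w (2 * j) = ThetaKN 4 1 0 τ := by
    unfold ThetaKN
    refine tsum_congr fun j => ?_
    simp only [hwdef]
    rw [zpow_mul, show s ^ (2 : ℤ) = 1 from by exact_mod_cast hs, one_zpow, one_mul]
    congr 1; push_cast; ring
  have t2 : ∑' j, w (2 * j + 1) = s * ThetaKN 4 3 0 τ := by
    unfold ThetaKN
    rw [← tsum_mul_left, ← (Equiv.subLeft (-1 : ℤ)).tsum_eq]
    refine tsum_congr fun j => ?_
    simp only [hwdef, Equiv.subLeft_apply]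
    rw [zpow_add_one₀ hs0, zpow_mul, show s ^ (2 : ℤ) = 1 from by exact_mod_cast hs, one_zpow,
      one_mul]
    congr 2; push_cast; ring
  rw [t1, t2] at h1
  rw [← h1]
  have h0 : w 0 = exp (cπ * I * τ / 8) := by simp [hwdef]
  rw [h0, mul_assoc (EE _), mul_comm (∏' k : ℕ, (1 + s * p ^ 3 * (p ^ 4) ^ k))]
  have hsp := tprod_split hp2 (s * p)
  rw [← hsp]
  congr 3
  · congr 1; ext k
    have : p ^ 4 / (s * p ^ 3) = s * p := by
      rw [div_eq_mul_inv, mul_inv, hsi]; field_simp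
    rw [this]; ring
  · congr 1; ext k; ring

lemma theta_even {τ : ℂ} (hτ : 0 < τ.im) :
    ThetaKN 4 0 0 τ - ThetaKN 4 4 0 τ =
      EE (exp (cπ * I * τ) ^ 4) *
        (∏' k : ℕ, (1 + -exp (cπ * I * τ) ^ 2 * (exp (cπ * I * τ) ^ 4) ^ k)) ^ 2 := by
  set p := exp (cπ * I * τ) with hpdef
  have hp0 : p ≠ 0 := exp_ne_zero _
  have hp : ‖p‖ < 1 := norm_exp_lt hτ
  have hp4 : ‖p ^ 4‖ < 1 := by
    rw [norm_pow]; exact pow_lt_one₀ (norm_nonneg _) hp (by norm_num)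
  set w : ℤ → ℂ := fun m => (-1) ^ m * exp (cπ * I * τ * (2 * m ^ 2)) with hwdef
  have hw : ∀ j, w (j + 1) = (-p ^ 2) * (p ^ 4) ^ j * w j := by
    intro j
    have e1 : (p ^ 4) ^ j = exp (cπ * I * τ * (4 * j)) := by
      rw [hpdef, ← exp_nat_mul, ← exp_int_mul]; congr 1; push_cast; ring
    have e2 : p ^ 2 = exp (cπ * I * τ * 2) := by
      rw [hpdef, ← exp_nat_mul]; congr 1; push_cast; ring
    simp only [hwdef]
    rw [zpow_add_one₀ (by norm_num), e1, e2]
    have : exp (cπ * I * τ * (2 * ((j + 1 : ℤ) : ℂ) ^ 2)) =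
        exp (cπ * I * τ * 2) * exp (cπ * I * τ * (4 * j)) *
          exp (cπ * I * τ * (2 * j ^ 2)) := by
      rw [← exp_add, ← exp_add]; congr 1; push_cast; ring
    rw [this]; ring
  have h := jtp (pow_ne_zero 4 hp0) hp4 (neg_ne_zero.mpr (pow_ne_zero 2 hp0)) w hw
  have h1 := tsum_int_even_odd h.summable
  rw [h.tsum_eq] at h1
  have t1 : ∑' j, w (2 * j) = ThetaKN 4 0 0 τ := by
    unfold ThetaKN
    refine tsum_congr fun j => ?_
    simp only [hwdef]
    rw [zpow_mul, show (-1 : ℂ) ^ (2 : ℤ) = 1 from by norm_num, one_zpow, one_mul]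
    congr 1; push_cast; ring
  have t2 : ∑' j, w (2 * j + 1) = - ThetaKN 4 4 0 τ := by
    unfold ThetaKN
    rw [← tsum_neg]
    refine tsum_congr fun j => ?_
    simp only [hwdef]
    rw [zpow_add_one₀ (by norm_num), zpow_mul, show (-1 : ℂ) ^ (2 : ℤ) = 1 from by norm_num,
      one_zpow, one_mul, neg_one_mul]
    congr 2; push_cast; ring
  rw [t1, t2, ← sub_eq_add_neg] at h1
  rw [← h1]
  have h0 : w 0 = 1 := by simp [hwdef]
  have : p ^ 4 / (-p ^ 2) = -p ^ 2 := by field_simp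
  rw [h0, this]; ring

/-- For every `τ ∈ ℍ`:
`(θ_{4,1}(0,τ) - θ_{4,3}(0,τ))/η(τ) = φ₁(τ)⁻¹`,
`(θ_{4,1}(0,τ) + θ_{4,3}(0,τ))/η(τ) = φ₂(τ)⁻¹`, and
`(θ_{4,0}(0,τ) - θ_{4,4}(0,τ))/(√2 η(τ)) = φ₃(τ)⁻¹`. -/
theorem theta4_eta_identities (τ : ℂ) (hτ : 0 < τ.im) :
    (ThetaKN 4 1 0 τ - ThetaKN 4 3 0 τ) / DEta τ = (Phi1 τ)⁻¹ ∧
    (ThetaKN 4 1 0 τ + ThetaKN 4 3 0 τ) / DEta τ = (Phi2 τ)⁻¹ ∧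
    (ThetaKN 4 0 0 τ - ThetaKN 4 4 0 τ) / ((Real.sqrt 2 : ℂ) * DEta τ) = (Phi3 τ)⁻¹ := by
  set p := exp (cπ * I * τ) with hpdef
  set e := exp (cπ * I * τ / 24) with hedef
  have he : e ≠ 0 := exp_ne_zero _
  have hp0 : p ≠ 0 := exp_ne_zero _
  have hp : ‖p‖ < 1 := norm_exp_lt hτ
  have hp2 : ‖p ^ 2‖ < 1 := by
    rw [norm_pow]; exact pow_lt_one₀ (norm_nonneg _) hp (by norm_num)
  have hp4 : ‖p ^ 4‖ < 1 := by
    rw [norm_pow]; exact pow_lt_one₀ (norm_nonneg _) hp (by norm_num)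
  have hA := EE_ne hp
  have hB := EE_ne hp2
  have hC := EE_ne hp4
  have d1 : DEta τ = e ^ 2 * EE (p ^ 2) := by
    have a1 : exp (2 * cπ * I * τ) = p ^ 2 := by
      rw [hpdef, ← exp_nat_mul]; congr 1; push_cast; ring
    have a2 : exp (cπ * I * τ / 12) = e ^ 2 := by
      rw [hedef, ← exp_nat_mul]; congr 1; push_cast; ring
    rw [DEta, a1, a2, EE]
  have d2 : DEta (τ / 2) = e * EE p := by
    have a1 : exp (2 * cπ * I * (τ / 2)) = p := by
      rw [hpdef]; congr 1; ring
    have a2 : exp (cπ * I * (τ / 2) / 12) = e := by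
      rw [hedef]; congr 1; ring
    rw [DEta, a1, a2, EE]
  have d3 : DEta (2 * τ) = e ^ 4 * EE (p ^ 4) := by
    have a1 : exp (2 * cπ * I * (2 * τ)) = p ^ 4 := by
      rw [hpdef, ← exp_nat_mul]; congr 1; push_cast; ring
    have a2 : exp (cπ * I * (2 * τ) / 12) = e ^ 4 := by
      rw [hedef, ← exp_nat_mul]; congr 1; push_cast; ring
    rw [DEta, a1, a2, EE]
  have e3 : exp (cπ * I * τ / 8) = e ^ 3 := by
    rw [hedef, ← exp_nat_mul]; congr 1; push_cast; ring
  have o1 := theta_odd hτ 1 (by norm_num)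
  have o2 := theta_odd hτ (-1) (by norm_num)
  have o3 := theta_even hτ
  rw [← hpdef] at o1 o2 o3
  rw [e3] at o1 o2
  rw [one_mul] at o1
  rw [neg_one_mul, ← sub_eq_add_neg] at o2
  -- product relations
  have r1 : (∏' k : ℕ, (1 + -1 * p * (p ^ 2) ^ k)) * EE (p ^ 2) = EE p := by
    rw [EE_eq p, ← tprod_split hp, EE_eq (p ^ 2)]
    congr 1
    · congr 1; ext k; ring
    · congr 1; ext k; ring
  have r2 : (∏' k : ℕ, (1 + -p ^ 2 * (p ^ 4) ^ k)) * EE (p ^ 4) = EE (p ^ 2) := by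
    rw [EE_eq (p ^ 2), ← tprod_split hp2, EE_eq (p ^ 4)]
    congr 1
    · congr 1; ext k; ring
    · congr 1; ext k; ring
  have r3 : (∏' k : ℕ, (1 + 1 * p * (p ^ 2) ^ k)) * (∏' k : ℕ, (1 + -1 * p * (p ^ 2) ^ k)) =
      ∏' k : ℕ, (1 + -p ^ 2 * (p ^ 4) ^ k) := by
    rw [← (mult_aux hp2 _).tprod_mul (mult_aux hp2 _)]
    congr 1; ext k; ring
  rw [o1, o2, o3, Phi1, Phi2, Phi3, d1, d2, d3]
  generalize (∏' k : ℕ, (1 + 1 * p * (p ^ 2) ^ k)) = u at *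
  generalize (∏' k : ℕ, (1 + -1 * p * (p ^ 2) ^ k)) = v at *
  generalize (∏' k : ℕ, (1 + -p ^ 2 * (p ^ 4) ^ k)) = d at *
  generalize EE p = A at *
  generalize EE (p ^ 2) = B at *
  generalize EE (p ^ 4) = C at *
  have hs2 : (Real.sqrt 2 : ℂ) ≠ 0 := by
    exact_mod_cast (Real.sqrt_pos.mpr (by norm_num : (0 : ℝ) < 2)).ne'
  generalize (Real.sqrt 2 : ℂ) = r at *
  clear_value e p
  subst r3 r2 r1
  have hu : u ≠ 0 := by rintro rfl; simp at hB
  have hv : v ≠ 0 := by rintro rfl; simp at hB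
  refine ⟨?_, ?_, ?_⟩
  · field_simp
  · field_simp
  · field_simp
end

section
/- For every τ in the upper half-plane, θ_{6,1}(0,τ) − θ_{6,5}(0,τ) = η(τ). -/
open Complex

section helpers
open Filter Topology

lemma pent_prod_bound {x : ℂ} (hx : ‖x‖ < 1) (k n : ℕ) :
    ‖∏ i ∈ Finset.range n, (1 - x ^ (k + i + 1))‖ ≤ Real.exp ((1 - ‖x‖)⁻¹) := by
  have h0 : 0 ≤ ‖x‖ := norm_nonneg x
  rw [norm_prod]
  calc ∏ i ∈ Finset.range n, ‖1 - x ^ (k + i + 1)‖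
      ≤ ∏ i ∈ Finset.range n, Real.exp (‖x‖ ^ i) := by
        refine Finset.prod_le_prod (fun i _ => norm_nonneg _) (fun i _ => ?_)
        calc ‖1 - x ^ (k + i + 1)‖ ≤ ‖(1 : ℂ)‖ + ‖x ^ (k + i + 1)‖ := norm_sub_le _ _
          _ = ‖x‖ ^ (k + i + 1) + 1 := by rw [norm_one, norm_pow, add_comm]
          _ ≤ ‖x‖ ^ i + 1 := by
            have := pow_le_pow_of_le_one h0 hx.le (show i ≤ k + i + 1 by omega)
            linarith
          _ ≤ _ := Real.add_one_le_exp _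
    _ = Real.exp (∑ i ∈ Finset.range n, ‖x‖ ^ i) := (Real.exp_sum _ _).symm
    _ ≤ _ := by
      apply Real.exp_le_exp.mpr
      rw [← tsum_geometric_of_lt_one h0 hx]
      exact (summable_geometric_of_lt_one h0 hx).sum_le_tsum _ (fun i _ => by positivity)

lemma pent_term_bound {x : ℂ} (hx : ‖x‖ < 1) (k n : ℕ) :
    ‖x ^ ((k + 1) * n) * ∏ i ∈ Finset.range (n + 1), (1 - x ^ (k + i + 1))‖ ≤
      ‖x‖ ^ n * Real.exp ((1 - ‖x‖)⁻¹) := by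
  rw [norm_mul, norm_pow]
  exact mul_le_mul (pow_le_pow_of_le_one (norm_nonneg x) hx.le (by nlinarith))
    (pent_prod_bound hx k _) (norm_nonneg _) (by positivity)

lemma pent_summable {x : ℂ} (hx : ‖x‖ < 1) :
    Summable (fun k : ℤ => ((Int.negOnePow k : ℤˣ) : ℂ) * x ^ pentagonal k) := by
  have hg := summable_geometric_of_lt_one (norm_nonneg x) hx
  have hn : ∀ k : ℤ, ‖((Int.negOnePow k : ℤˣ) : ℂ)‖ = 1 := by
    intro k
    rcases Int.units_eq_one_or (Int.negOnePow k) with h | h <;> simp [h]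
  refine Summable.of_nat_of_neg_add_one ?_ ?_
  · refine Summable.of_norm_bounded hg fun k => ?_
    rw [norm_mul, hn, one_mul, norm_pow]
    refine pow_le_pow_of_le_one (norm_nonneg x) hx.le ?_
    have := two_mul_natCast_pentagonal k
    have h2 : (k : ℤ) ≤ k * k := by exact_mod_cast Nat.le_mul_self k
    zify; nlinarith
  · refine Summable.of_norm_bounded hg fun k => ?_
    rw [norm_mul, hn, one_mul, norm_pow]
    refine pow_le_pow_of_le_one (norm_nonneg x) hx.le ?_
    have := two_mul_natCast_pentagonal (-((k : ℤ) + 1))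
    zify; nlinarith

lemma pent_hasSum_nat {x : ℂ} (hx : ‖x‖ < 1) :
    HasSum (fun k : ℕ => (-1) ^ k * (x ^ pentagonal (-k) - x ^ pentagonal (k + 1)))
      (∑' k : ℤ, ((Int.negOnePow k : ℤˣ) : ℂ) * x ^ pentagonal k) := by
  have h := (pent_summable hx).hasSum
  rw [← neg_injective.hasSum_iff (fun x hx ↦ by absurd hx; use -x; simp)] at h
  convert h.nat_add_neg_add_one using 2 with k
  simp_rw [Function.comp_apply, neg_neg, Int.negOnePow_add]
  simp [Int.negOnePow_def]
  ring

lemma pent_complex {x : ℂ} (hx : ‖x‖ < 1) :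
    ∏' n : ℕ, (1 - x ^ (n + 1)) = ∑' k : ℤ, ((Int.negOnePow k : ℤˣ) : ℂ) * x ^ pentagonal k := by
  have h0 := norm_nonneg x
  have hg := summable_geometric_of_lt_one h0 hx
  rw [← (pent_hasSum_nat hx).tsum_eq]
  refine Pentagonal.tprod_one_sub_pow ?_ ?_ ?_ (pent_hasSum_nat hx).summable ?_
  · exact tendsto_pow_atTop_nhds_zero_of_norm_lt_one hx
  · exact fun k => Summable.of_norm_bounded (hg.mul_right _) (pent_term_bound hx k)
  · intro k
    simp_rw [sub_eq_add_neg]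
    apply multipliable_one_add_of_summable
    refine Summable.of_nonneg_of_le (fun _ => norm_nonneg _) (fun n => ?_) hg
    rw [norm_neg, norm_pow]
    exact pow_le_pow_of_le_one h0 hx.le (by omega)
  · have hlim : Tendsto (fun k : ℕ => ‖x‖ ^ k * ∑' n : ℕ, ‖x‖ ^ n * Real.exp ((1 - ‖x‖)⁻¹))
        atTop (𝓝 0) := by
      simpa using (tendsto_pow_atTop_nhds_zero_of_lt_one h0 hx).mul_const
        (∑' n : ℕ, ‖x‖ ^ n * Real.exp ((1 - ‖x‖)⁻¹))
    refine squeeze_zero_norm (fun k => ?_) hlim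
    rw [norm_mul, norm_mul, norm_pow, norm_pow, norm_neg, norm_one, one_pow, one_mul]
    refine mul_le_mul (pow_le_pow_of_le_one h0 hx.le ?_)
      (tsum_of_norm_bounded (hg.mul_right _).hasSum (pent_term_bound hx k)) (norm_nonneg _)
      (by positivity)
    rw [Nat.le_div_iff_mul_le (by norm_num)]
    nlinarith

lemma hasSum_int_even_odd {f : ℤ → ℂ} {a b : ℂ} (he : HasSum (fun j : ℤ => f (2 * j)) a)
    (ho : HasSum (fun j : ℤ => f (2 * j + 1)) b) : HasSum f (a + b) := by
  have h1 : Function.Injective (fun j : ℤ => 2 * j) := fun a b h => by simpa using h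
  have h2 : Function.Injective (fun j : ℤ => 2 * j + 1) := fun a b h => by simpa using h
  have he' := h1.hasSum_range_iff.mpr he
  have ho' := h2.hasSum_range_iff.mpr ho
  refine he'.add_isCompl ?_ ho'
  rw [← compl_eq_iff_isCompl]
  ext n
  simp only [Set.mem_compl_iff, Set.mem_range]
  constructor
  · intro h
    refine ⟨n / 2, ?_⟩
    by_contra hc
    exact h ⟨n / 2, by omega⟩
  · rintro ⟨j, rfl⟩ ⟨i, hi⟩
    omega

end helpers

/-- For every `τ ∈ ℍ`, `θ_{6,1}(0,τ) - θ_{6,5}(0,τ) = η(τ)`. -/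
theorem theta6_eta (τ : ℂ) (hτ : 0 < τ.im) :
    ThetaKN 6 1 0 τ - ThetaKN 6 5 0 τ = DEta τ := by
  set x := exp (2 * cπ * I * τ) with hxdef
  have hx : ‖x‖ < 1 := by
    rw [hxdef, norm_exp, Real.exp_lt_one_iff]
    simp [cπ]
    positivity
  have hs := pent_summable hx
  have he : Summable (fun j : ℤ => ((Int.negOnePow (2 * j) : ℤˣ) : ℂ) * x ^ pentagonal (2 * j)) :=
    hs.comp_injective (i := fun j : ℤ => 2 * j) (fun a b h => by simpa using h)
  have ho : Summable (fun j : ℤ =>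
      ((Int.negOnePow (2 * j + 1) : ℤˣ) : ℂ) * x ^ pentagonal (2 * j + 1)) :=
    hs.comp_injective (i := fun j : ℤ => 2 * j + 1) (fun a b h => by simpa using h)
  have hsum := (hasSum_int_even_odd (f := fun k : ℤ => ((Int.negOnePow k : ℤˣ) : ℂ) * x ^ pentagonal k) he.hasSum ho.hasSum).tsum_eq
  have key : ∀ m : ℕ, x ^ m = exp (2 * cπ * I * τ * m) := by
    intro m
    rw [hxdef, ← Complex.exp_nat_mul]; ring_nf
  have h1 : ThetaKN 6 1 0 τ = exp (cπ * I * τ / 12) *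
      ∑' j : ℤ, ((Int.negOnePow (2 * j) : ℤˣ) : ℂ) * x ^ pentagonal (2 * j) := by
    rw [ThetaKN, ← tsum_mul_left, ← (Equiv.neg ℤ).tsum_eq]
    refine tsum_congr fun j => ?_
    have hp : (2 : ℂ) * pentagonal (2 * j) = (2 * j) * (3 * (2 * j) - 1) := by
      exact_mod_cast two_mul_natCast_pentagonal (2 * j)
    have hp' : (pentagonal (2 * j) : ℂ) = j * (6 * j - 1) := by linear_combination hp / 2
    rw [key, hp', Int.negOnePow_two_mul]
    simp only [Units.val_one, Int.cast_one, one_mul, ← Complex.exp_add]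
    congr 1
    push_cast [Equiv.neg_apply]
    ring
  have h2 : ThetaKN 6 5 0 τ = - (exp (cπ * I * τ / 12) *
      ∑' j : ℤ, ((Int.negOnePow (2 * j + 1) : ℤˣ) : ℂ) * x ^ pentagonal (2 * j + 1)) := by
    rw [ThetaKN, ← tsum_mul_left, ← tsum_neg]
    refine tsum_congr fun j => ?_
    have hp : (2 : ℂ) * pentagonal (2 * j + 1) = (2 * j + 1) * (3 * (2 * j + 1) - 1) := by
      exact_mod_cast two_mul_natCast_pentagonal (2 * j + 1)
    have hp' : (pentagonal (2 * j + 1) : ℂ) = (2 * j + 1) * (3 * j + 1) := by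
      linear_combination hp / 2
    rw [key, hp', Int.negOnePow_two_mul_add_one]
    simp only [Units.val_neg, Units.val_one, Int.cast_neg, Int.cast_one, neg_mul, one_mul, mul_neg,
      neg_neg, ← Complex.exp_add]
    congr 1
    push_cast
    ring
  rw [h1, h2, DEta, ← hxdef, pent_complex hx, hsum]
  ring
end

section
/- Let p ≥ 0 and κ ≥ 2p+3 be integers and set m = κ − 2p − 2 ≥ 1. Let c_0, …, c_m : ℍ → ℂ be holomorphic, and define v(λ,τ) = ϑ₁(λ,τ)^{p+1} Σ_{j=0}^m c_j(τ) θ^s_{m,j}(λ,τ). Then v satisfies the KZB heat equation 2πiκ ∂v/∂τ = ∂²v/∂λ² + p(p+1)ρ′(λ,τ)v at every (λ,τ) ∈ ℂ×ℍ with ϑ₁(λ,τ) ≠ 0 if and only if for every (λ,τ) ∈ ℂ×ℍ with ϑ₁(λ,τ) ≠ 0: (κ/(p+1)) Σ_{j=0}^m c_j′(τ) θ^s_{m,j}(λ,τ) = (2p+2−κ) (∂_τϑ₁(λ,τ)/ϑ₁(λ,τ)) Σ_{j=0}^m c_j(τ) θ^s_{m,j}(λ,τ) − 2 Σ_{j=0}^m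 c_j(τ) ∂_τθ^s_{m,j}(λ,τ) + (1/(πi)) (∂_λϑ₁(λ,τ)/ϑ₁(λ,τ)) Σ_{j=0}^m c_j(τ) ∂_λθ^s_{m,j}(λ,τ). -/
open Complex

lemma deriv2_jt (z : ℂ) {τ : ℂ} (hτ : 0 < im τ) :
    deriv (fun w => jacobiTheta₂' w τ) z = 4 * Real.pi * I * jacobiTheta₂_fderiv z τ (0, 1) := by
  set S : ℝ := |z.im| + 1 with hS
  have hopen : IsOpen {w : ℂ | |w.im| < S} :=
    isOpen_lt (continuous_abs.comp continuous_im) continuous_const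
  have hu : Summable (fun n : ℤ => 2 * Real.pi * |(n:ℝ)| *
      Real.exp (-Real.pi * (τ.im * n ^ 2 - 2 * S * |(n:ℝ)|))) := by
    have := (summable_pow_mul_jacobiTheta₂_term_bound S hτ 1).mul_left (2 * Real.pi)
    refine this.congr fun n => ?_
    push_cast
    ring
  have hd : ∀ (n : ℤ) (w : ℂ), HasDerivAt (fun w => jacobiTheta₂'_term n w τ)
      (2 * Real.pi * I * n * (2 * Real.pi * I * n * jacobiTheta₂_term n w τ)) w := by
    intro n w
    unfold jacobiTheta₂'_term jacobiTheta₂_term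
    have h0 : HasDerivAt (fun w : ℂ => 2 * Real.pi * I * n * w + Real.pi * I * n ^ 2 * τ)
        (2 * Real.pi * I * n) w := by
      simpa using ((hasDerivAt_id w).const_mul (2 * Real.pi * I * (n:ℂ))).add_const
        (Real.pi * I * n ^ 2 * τ)
    have h1 := h0.cexp
    rw [mul_comm (exp _)] at h1
    exact h1.const_mul _
  have h := hasSum_deriv_of_summable_norm (F := fun n w => jacobiTheta₂'_term n w τ) (z := z)
    hu (fun n w _ => (hd n w).differentiableAt.differentiableWithinAt) hopen
    (fun n w (hw : |w.im| < S) => by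
      simpa using norm_jacobiTheta₂'_term_le hτ hw.le le_rfl n) (by simp [hS])
  have h2 := ((hasSum_jacobiTheta₂_term_fderiv z hτ).mapL
    (ContinuousLinearMap.apply ℂ ℂ ((0, 1) : ℂ × ℂ))).mul_left (4 * Real.pi * I)
  refine h.unique ?_
  have h3 : ∀ n : ℤ, 4 * Real.pi * I * (ContinuousLinearMap.apply ℂ ℂ ((0, 1) : ℂ × ℂ))
      (jacobiTheta₂_term_fderiv n z τ) = deriv (fun w => jacobiTheta₂'_term n w τ) z := by
    intro n
    rw [(hd n z).deriv]
    simp [jacobiTheta₂_term_fderiv, jacobiTheta₂_term]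
    ring_nf
  rw [funext h3] at h2
  exact h2

structure Heat (C : ℂ) (f : ℂ → ℂ → ℂ) : Prop where
  dt : ∀ z τ : ℂ, 0 < τ.im → DifferentiableAt ℂ (fun t => f z t) τ
  dz : ∀ τ : ℂ, 0 < τ.im → Differentiable ℂ (fun w => f w τ)
  heat : ∀ z τ : ℂ, 0 < τ.im →
    deriv (deriv (fun w => f w τ)) z = C * deriv (fun t => f z t) τ

/-- Substitution `z ↦ α z + β` and scaling. -/
lemma Heat.affine {C : ℂ} {f : ℂ → ℂ → ℂ} (h : Heat C f) (s α β : ℂ) :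
    Heat (α ^ 2 * C) (fun z τ => s * f (α * z + β) τ) where
  dt z τ hτ := (h.dt _ τ hτ).const_mul s
  dz τ hτ := ((h.dz τ hτ).comp ((differentiable_id.const_mul α).add_const β)).const_mul s
  heat z τ hτ := by
    have ha : ∀ z, HasDerivAt (fun z => α * z + β) α z := fun z => by
      simpa using ((hasDerivAt_id z).const_mul α).add_const β
    have h1 : deriv (fun w => s * f (α * w + β) τ) =
        fun w => s * (deriv (fun w => f w τ) (α * w + β) * α) := by
      funext w
      exact (((h.dz τ hτ _).hasDerivAt.comp w (ha w)).const_mul s).deriv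
    have h2 : Differentiable ℂ (deriv (fun w => f w τ)) := (h.dz τ hτ).deriv
    rw [h1, deriv_const_mul_field]
    have h3 := (((h2 _).hasDerivAt.comp z (ha z)).mul_const α).const_mul s
    have h4 : deriv (fun w => s * (deriv (fun w => f w τ) (α * w + β) * α)) z = _ := h3.deriv
    rw [deriv_const_mul_field] at h4
    rw [h4, h.heat _ τ hτ, deriv_const_mul_field]
    ring

lemma Heat.add {C : ℂ} {f g : ℂ → ℂ → ℂ} (hf : Heat C f) (hg : Heat C g) :
    Heat C (fun z τ => f z τ + g z τ) where
  dt z τ hτ := (hf.dt _ τ hτ).add (hg.dt _ τ hτ)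
  dz τ hτ := (hf.dz τ hτ).add (hg.dz τ hτ)
  heat z τ hτ := by
    have h1 : deriv (fun w => f w τ + g w τ) =
        fun w => deriv (fun w => f w τ) w + deriv (fun w => g w τ) w := by
      funext w
      exact ((hf.dz τ hτ w).hasDerivAt.add (hg.dz τ hτ w).hasDerivAt).deriv
    have h3 := ((hf.dz τ hτ).deriv z).hasDerivAt.add ((hg.dz τ hτ).deriv z).hasDerivAt
    have h4 := (hf.dt z τ hτ).hasDerivAt.add (hg.dt z τ hτ).hasDerivAt
    rw [h1]
    refine h3.deriv.trans ?_
    rw [show deriv (fun t => f z t + g z t) τ = _ from h4.deriv, hf.heat z τ hτ, hg.heat z τ hτ]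
    ring

lemma heat_G {k : ℝ} (hk : 0 < k) (a : ℂ) :
    Heat (2 * Real.pi * I * k) (fun z τ =>
      exp (2 * Real.pi * I * k * a ^ 2 * τ + 2 * Real.pi * I * k * a * z) *
        jacobiTheta₂ (k * z + 2 * k * a * τ) (2 * k * τ)) := by
  have him : ∀ τ : ℂ, 0 < τ.im → 0 < (2 * (k:ℂ) * τ).im := by
    intro τ hτ
    have : (2 * (k:ℂ) * τ).im = 2 * k * τ.im := by simp
    rw [this]; positivity
  have hfd : ∀ z τ : ℂ, ∀ x y : ℂ, jacobiTheta₂_fderiv z τ (x, y) =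
      x * jacobiTheta₂_fderiv z τ (1, 0) + y * jacobiTheta₂_fderiv z τ (0, 1) := by
    intro z τ x y
    rw [show ((x, y) : ℂ × ℂ) = x • (1, 0) + y • (0, 1) by simp, map_add, map_smul, map_smul]
    simp
  have hz1 : ∀ z τ : ℂ, 0 < τ.im → jacobiTheta₂' z τ = jacobiTheta₂_fderiv z τ (1, 0) := by
    intro z τ hτ
    refine (hasDerivAt_jacobiTheta₂_fst z hτ).unique ?_
    have := (hasFDerivAt_jacobiTheta₂ z hτ).comp_hasDerivAt z
      ((hasDerivAt_id z).prodMk (hasDerivAt_const z τ))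
    exact this
  have hzz : ∀ z τ : ℂ, 0 < τ.im → HasDerivAt (fun w => jacobiTheta₂' w τ)
      (4 * Real.pi * I * jacobiTheta₂_fderiv z τ (0, 1)) z := by
    intro z τ hτ
    rw [← deriv2_jt z hτ]
    have h1 : (fun w => jacobiTheta₂' w τ) = deriv (fun w => jacobiTheta₂ w τ) := by
      funext w; exact (hasDerivAt_jacobiTheta₂_fst w hτ).deriv.symm
    rw [h1]
    have : Differentiable ℂ (fun w => jacobiTheta₂ w τ) :=
      fun w => differentiableAt_jacobiTheta₂_fst w hτ
    exact (this.deriv z).hasDerivAt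
  have hEz : ∀ z τ : ℂ, HasDerivAt
      (fun z => exp (2 * Real.pi * I * k * a ^ 2 * τ + 2 * Real.pi * I * k * a * z))
      (exp (2 * Real.pi * I * k * a ^ 2 * τ + 2 * Real.pi * I * k * a * z) *
        (2 * Real.pi * I * k * a)) z := by
    intro z τ
    refine HasDerivAt.cexp ?_
    simpa using ((hasDerivAt_id z).const_mul (2 * Real.pi * I * k * a)).const_add
      (2 * Real.pi * I * k * a ^ 2 * τ)
  have hEt : ∀ z τ : ℂ, HasDerivAt
      (fun τ => exp (2 * Real.pi * I * k * a ^ 2 * τ + 2 * Real.pi * I * k * a * z))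
      (exp (2 * Real.pi * I * k * a ^ 2 * τ + 2 * Real.pi * I * k * a * z) *
        (2 * Real.pi * I * k * a ^ 2)) τ := by
    intro z τ
    refine HasDerivAt.cexp ?_
    simpa using ((hasDerivAt_id τ).const_mul (2 * Real.pi * I * k * a ^ 2)).add_const
      (2 * Real.pi * I * k * a * z)
  have haz : ∀ z τ : ℂ, HasDerivAt (fun z => (k:ℂ) * z + 2 * k * a * τ) k z := fun z τ => by
    simpa using ((hasDerivAt_id z).const_mul (k:ℂ)).add_const (2 * k * a * τ)
  have hat : ∀ z τ : ℂ, HasDerivAt (fun τ => (k:ℂ) * z + 2 * k * a * τ) (2 * k * a) τ :=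
    fun z τ => by
    simpa using ((hasDerivAt_id τ).const_mul (2 * k * a)).const_add ((k:ℂ) * z)
  have hbt : ∀ τ : ℂ, HasDerivAt (fun τ => 2 * (k:ℂ) * τ) (2 * k) τ :=
    fun τ => by
    simpa using ((hasDerivAt_id τ).const_mul (2 * (k:ℂ)))
  have hJz : ∀ z τ : ℂ, 0 < τ.im → HasDerivAt
      (fun z => jacobiTheta₂ (k * z + 2 * k * a * τ) (2 * k * τ))
      (jacobiTheta₂' (k * z + 2 * k * a * τ) (2 * k * τ) * k) z := fun z τ hτ =>
    HasDerivAt.comp (h₂ := fun w => jacobiTheta₂ w (2 * k * τ)) z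
      (hasDerivAt_jacobiTheta₂_fst (k * z + 2 * k * a * τ) (him τ hτ)) (haz z τ)
  have hJzz : ∀ z τ : ℂ, 0 < τ.im → HasDerivAt
      (fun z => jacobiTheta₂' (k * z + 2 * k * a * τ) (2 * k * τ))
      (4 * Real.pi * I * jacobiTheta₂_fderiv (k * z + 2 * k * a * τ) (2 * k * τ) (0, 1) * k) z :=
    fun z τ hτ => HasDerivAt.comp (h₂ := fun w => jacobiTheta₂' w (2 * k * τ)) z
      (hzz (k * z + 2 * k * a * τ) _ (him τ hτ)) (haz z τ)
  have hJt : ∀ z τ : ℂ, 0 < τ.im → HasDerivAt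
      (fun τ => jacobiTheta₂ (k * z + 2 * k * a * τ) (2 * k * τ))
      (2 * k * a * jacobiTheta₂' (k * z + 2 * k * a * τ) (2 * k * τ) +
        2 * k * jacobiTheta₂_fderiv (k * z + 2 * k * a * τ) (2 * k * τ) (0, 1)) τ := by
    intro z τ hτ
    have := (hasFDerivAt_jacobiTheta₂ (k * z + 2 * k * a * τ) (him τ hτ)).comp_hasDerivAt τ
      ((hat z τ).prodMk (hbt τ))
    rw [hfd, ← hz1 _ _ (him τ hτ)] at this
    exact this
  refine ⟨fun z τ hτ => ((hEt z τ).mul (hJt z τ hτ)).differentiableAt,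
    fun τ hτ z => ((hEz z τ).mul (hJz z τ hτ)).differentiableAt, fun z τ hτ => ?_⟩
  have hT := ((hEt z τ).mul (hJt z τ hτ)).deriv
  have h1 : deriv (fun z => exp (2 * Real.pi * I * k * a ^ 2 * τ + 2 * Real.pi * I * k * a * z) *
        jacobiTheta₂ (k * z + 2 * k * a * τ) (2 * k * τ)) = _ :=
    funext fun z => ((hEz z τ).mul (hJz z τ hτ)).deriv
  have h2 := (((hEz z τ).mul_const (2 * Real.pi * I * k * a)).mul (hJz z τ hτ)).add
    ((hEz z τ).mul ((hJzz z τ hτ).mul_const (k:ℂ)))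
  rw [h1]
  refine h2.deriv.trans ?_
  refine Eq.trans ?_ (congrArg _ hT.symm)
  ring

lemma ThetaKN_eq (κ : ℕ) (n : ℤ) (z τ : ℂ) :
    ThetaKN κ n z τ = exp (2 * Real.pi * I * (κ:ℝ) * (n / (2 * κ)) ^ 2 * τ +
      2 * Real.pi * I * (κ:ℝ) * (n / (2 * κ)) * z) *
        jacobiTheta₂ ((κ:ℝ) * z + 2 * (κ:ℝ) * (n / (2 * κ)) * τ) (2 * (κ:ℝ) * τ) := by
  unfold ThetaKN jacobiTheta₂ jacobiTheta₂_term
  rw [← tsum_mul_left]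
  refine tsum_congr fun j => ?_
  rw [← exp_add, cπ]
  congr 1
  push_cast
  ring

lemma heat_ThetaKN {κ : ℕ} (hκ : 0 < κ) (n : ℤ) : Heat (2 * cπ * I * κ) (ThetaKN κ n) := by
  have h := heat_G (k := (κ:ℝ)) (by exact_mod_cast hκ) ((n:ℂ) / (2 * κ))
  have h2 : ThetaKN κ n = _ := funext fun z => funext fun τ => ThetaKN_eq κ n z τ
  rw [h2, cπ]
  exact_mod_cast h

lemma heat_ThetaS {κ : ℕ} (hκ : 0 < κ) (n : ℤ) : Heat (2 * cπ * I * κ) (ThetaS κ n) := by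
  have h := heat_ThetaKN hκ n
  have hneg := h.affine 1 (-1) 0
  simp only [neg_mul, one_mul, add_zero, even_two, Even.neg_pow, one_pow] at hneg
  exact h.add hneg

/-- Gaussian binomial coefficients, via the Pascal recursion. -/
noncomputable def gb (q : ℂ) : ℕ → ℕ → ℂ
  | _, 0 => 1
  | 0, _ + 1 => 0
  | n + 1, k + 1 => gb q n k + q ^ (k + 1) * gb q n (k + 1)

lemma gb_zero_right (q : ℂ) (n : ℕ) : gb q n 0 = 1 := by cases n <;> rfl

lemma gb_succ (q : ℂ) (n k : ℕ) :
    gb q (n + 1) (k + 1) = gb q n k + q ^ (k + 1) * gb q n (k + 1) := rfl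

lemma gb_eq_zero (q : ℂ) : ∀ n k : ℕ, n < k → gb q n k = 0
  | 0, k + 1, _ => rfl
  | n + 1, k + 1, h => by
    rw [gb_succ, gb_eq_zero q n k (by omega), gb_eq_zero q n (k + 1) (by omega)]; simp

lemma gb_self (q : ℂ) : ∀ n : ℕ, gb q n n = 1
  | 0 => rfl
  | n + 1 => by rw [gb_succ, gb_self q n, gb_eq_zero q n (n + 1) (by omega)]; simp

noncomputable def qp (q : ℂ) (n : ℕ) : ℂ := ∏ k ∈ Finset.range n, (1 - q ^ (k + 1))

lemma qp_succ (q : ℂ) (n : ℕ) : qp q (n + 1) = qp q n * (1 - q ^ (n + 1)) :=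
  Finset.prod_range_succ _ _

lemma qp_mul_gb (q : ℂ) : ∀ a b : ℕ, qp q a * qp q b * gb q (a + b) a = qp q (a + b)
  | 0, b => by simp [qp, gb_zero_right]
  | a + 1, 0 => by simp [qp, gb_self]
  | a + 1, b + 1 => by
    have h1 := qp_mul_gb q a (b + 1)
    have h2 := qp_mul_gb q (a + 1) b
    rw [show a + 1 + (b + 1) = (a + b + 1) + 1 by ring, gb_succ, qp_succ q (a + b + 1)]
    rw [show a + (b + 1) = a + b + 1 by ring] at h1
    rw [show a + 1 + b = a + b + 1 by ring] at h2
    rw [qp_succ q a] at h2 ⊢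
    rw [qp_succ q b] at h1 ⊢
    linear_combination (1 - q ^ (a + 1)) * h1 + q ^ (a + 1) * (1 - q ^ (b + 1)) * h2

/-- The `q`-binomial theorem with `q = r ^ 2`. -/
lemma qbinom (r : ℂ) : ∀ (N : ℕ) (x : ℂ),
    ∏ k ∈ Finset.range N, (1 + x * (r ^ 2) ^ k) =
      ∑ i ∈ Finset.range (N + 1), gb (r ^ 2) N i * r ^ (i * (i - 1)) * x ^ i
  | 0, x => by simp [gb_zero_right]
  | N + 1, x => by
    rw [Finset.prod_range_succ']
    have h := qbinom r N (x * r ^ 2)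
    have e : ∀ k, 1 + x * (r ^ 2) ^ (k + 1) = 1 + (x * r ^ 2) * (r ^ 2) ^ k := fun k => by ring
    simp only [e, h]
    conv_rhs => rw [Finset.sum_range_succ']
    simp only [gb_succ, gb_zero_right]
    have e2 : ∀ i, (gb (r ^ 2) N i + (r ^ 2) ^ (i + 1) * gb (r ^ 2) N (i + 1)) *
        r ^ ((i + 1) * (i + 1 - 1)) * x ^ (i + 1) =
        x * (gb (r ^ 2) N i * r ^ (i * (i - 1)) * (x * r ^ 2) ^ i) +
        gb (r ^ 2) N (i + 1) * r ^ ((i + 1) * (i + 1 - 1)) * (x * r ^ 2) ^ (i + 1) := by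
      intro i
      have : r ^ ((i + 1) * (i + 1 - 1)) = r ^ (i * (i - 1)) * (r ^ 2) ^ i := by
        rw [← pow_mul, ← pow_add]
        congr 1
        cases i with
        | zero => rfl
        | succ n => simp; ring
      rw [this]
      ring
    simp only [e2]
    rw [Finset.sum_add_distrib, ← Finset.mul_sum]
    have e3 := Finset.sum_range_succ' (fun i => gb (r ^ 2) N i * r ^ (i * (i - 1)) * (x * r ^ 2) ^ i)
      (N + 1)
    rw [Finset.sum_range_succ, gb_eq_zero _ N (N + 1) (by omega)] at e3
    simp only [gb_zero_right] at e3
    simp only [zero_mul, add_zero, pow_zero, mul_one] at e3 ⊢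
    rw [add_assoc, ← e3]
    ring

/-- Finite form of the Jacobi triple product. -/
lemma finite_triple {r w : ℂ} (hr : r ≠ 0) (hw : w ≠ 0) (n : ℕ) :
    ∏ k ∈ Finset.range n, ((1 - (r ^ 2) ^ (k + 1) * w) * (1 - (r ^ 2) ^ k * w⁻¹)) =
      ∑ i ∈ Finset.range (2 * n + 1), gb (r ^ 2) (2 * n) i *
        ((-1) ^ ((i : ℤ) - n) * r ^ (((i : ℤ) - n) * ((i : ℤ) - n + 1)) * w ^ ((i : ℤ) - n)) := by
  have hq : (r ^ 2) ≠ 0 := pow_ne_zero _ hr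
  have h := qbinom r (2 * n) (-w * (r ^ 2) * ((r ^ 2) ^ n)⁻¹)
  have hA : (-w) ^ n * (r ^ (n * (n - 1)))⁻¹ ≠ 0 := by
    have := pow_ne_zero n (neg_ne_zero.2 hw)
    have := pow_ne_zero (n * (n - 1)) hr
    positivity
  have hprod : ∏ k ∈ Finset.range (2 * n), (1 + -w * (r ^ 2) * ((r ^ 2) ^ n)⁻¹ * (r ^ 2) ^ k) =
      ((-w) ^ n * (r ^ (n * (n - 1)))⁻¹) *
      ∏ k ∈ Finset.range n, ((1 - (r ^ 2) ^ (k + 1) * w) * (1 - (r ^ 2) ^ k * w⁻¹)) := by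
    rw [two_mul, Finset.prod_range_add, Finset.prod_mul_distrib]
    have h1 : ∏ x ∈ Finset.range n, (1 + -w * r ^ 2 * ((r ^ 2) ^ n)⁻¹ * (r ^ 2) ^ (n + x)) =
        ∏ k ∈ Finset.range n, (1 - (r ^ 2) ^ (k + 1) * w) := by
      refine Finset.prod_congr rfl fun k _ => ?_
      have := pow_ne_zero n hq
      rw [pow_add]
      field_simp
      ring
    have h2 : ∏ x ∈ Finset.range n, (1 + -w * r ^ 2 * ((r ^ 2) ^ n)⁻¹ * (r ^ 2) ^ x) =
        ((-w) ^ n * (r ^ (n * (n - 1)))⁻¹) * ∏ k ∈ Finset.range n, (1 - (r ^ 2) ^ k * w⁻¹) := by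
      rw [← Finset.prod_range_reflect]
      have h3 : ∀ x ∈ Finset.range n,
          (1 + -w * r ^ 2 * ((r ^ 2) ^ n)⁻¹ * (r ^ 2) ^ (n - 1 - x)) =
          (-w) * ((r ^ 2) ^ x)⁻¹ * (1 - (r ^ 2) ^ x * w⁻¹) := by
        intro x hx
        have hx := Finset.mem_range.1 hx
        have : (r ^ 2) ^ n = (r ^ 2) ^ (n - 1 - x) * (r ^ 2) ^ x * r ^ 2 := by
          rw [← pow_add, ← pow_succ]; congr 1; omega
        rw [this]
        have h4 := pow_ne_zero x hq
        have h5 := pow_ne_zero (n - 1 - x) hq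
        generalize (r ^ 2) ^ x = A at *
        generalize (r ^ 2) ^ (n - 1 - x) = B at *
        field_simp
        ring
      rw [Finset.prod_congr rfl h3, Finset.prod_mul_distrib, Finset.prod_mul_distrib,
        Finset.prod_const, Finset.card_range, Finset.prod_inv_distrib, Finset.prod_pow_eq_pow_sum,
        ← pow_mul, mul_comm 2, Finset.sum_range_id_mul_two]
    rw [h1, h2]
    ring
  rw [hprod] at h
  refine mul_left_cancel₀ hA (h.trans ?_)
  rw [Finset.mul_sum]
  refine Finset.sum_congr rfl fun i _ => ?_
  rw [mul_assoc, mul_left_comm _ (gb _ _ _)]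
  congr 1
  have e1 : ∀ k : ℕ, r ^ (k * (k - 1)) = r ^ ((k : ℤ) * (k - 1)) := by
    intro k
    cases k with
    | zero => simp
    | succ k => rw [← zpow_natCast]; push_cast; simp
  rw [e1, e1]
  have e2 : -w * r ^ 2 * ((r ^ 2) ^ n)⁻¹ = (-w) * r ^ (2 - 2 * (n : ℤ)) := by
    rw [zpow_sub₀ hr, zpow_mul, zpow_natCast]
    norm_cast
    rw [div_eq_mul_inv, mul_assoc]
  rw [e2, mul_pow, ← zpow_natCast (r ^ _), ← zpow_mul, ← zpow_neg]
  have e3 : (-w) ^ i = (-w) ^ n * ((-1) ^ ((i : ℤ) - n) * w ^ ((i : ℤ) - n)) := by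
    rw [← mul_zpow, neg_one_mul, ← zpow_natCast, ← zpow_natCast,
      ← zpow_add₀ (neg_ne_zero.2 hw)]
    congr 1; ring
  rw [e3]
  have e4 : r ^ ((i : ℤ) * (i - 1)) * r ^ ((2 - 2 * (n : ℤ)) * i) =
      r ^ (-((n : ℤ) * (n - 1))) * r ^ (((i : ℤ) - n) * ((i : ℤ) - n + 1)) := by
    rw [← zpow_add₀ hr, ← zpow_add₀ hr]
    congr 1; ring
  linear_combination ((-w) ^ n * ((-1) ^ ((i : ℤ) - n) * w ^ ((i : ℤ) - n))) * e4

lemma qp_limit {q : ℂ} (hq : ‖q‖ < 1) : ∃ L : ℂ, L ≠ 0 ∧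
    Filter.Tendsto (qp q) Filter.atTop (nhds L) ∧ ∀ n, qp q n ≠ 0 := by
  have hs : Summable (fun n : ℕ => ‖-q ^ (n + 1)‖) := by
    simpa using (summable_nat_add_iff 1).mpr (summable_geometric_of_lt_one (norm_nonneg _) hq)
  have hne : ∀ n : ℕ, 1 + -q ^ (n + 1) ≠ 0 := by
    intro n h
    have h1 : q ^ (n + 1) = 1 := by linear_combination -h
    have h2 : ‖q‖ ^ (n + 1) < 1 := pow_lt_one₀ (norm_nonneg _) hq (by omega)
    rw [← norm_pow, h1] at h2
    simp at h2
  refine ⟨∏' n : ℕ, (1 + -q ^ (n + 1)), tprod_one_add_ne_zero_of_summable hne hs, ?_, ?_⟩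
  · have := (multipliable_one_add_of_summable hs).hasProd.tendsto_prod_nat
    simp only [← sub_eq_add_neg] at this ⊢
    exact this
  · intro n
    rw [qp]
    exact Finset.prod_ne_zero_iff.2 fun i _ => by simpa [sub_eq_add_neg] using hne i

lemma gb_bound {q : ℂ} (hq : ‖q‖ < 1) : ∃ M : ℝ, 0 ≤ M ∧ ∀ n k : ℕ, ‖gb q n k‖ ≤ M := by
  obtain ⟨L, hL, hlim, hne⟩ := qp_limit hq
  obtain ⟨A, hA⟩ := (Metric.isBounded_range_of_tendsto _ hlim).exists_norm_le
  obtain ⟨B, hB⟩ := (Metric.isBounded_range_of_tendsto _ (hlim.inv₀ hL)).exists_norm_le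
  have hA' : ∀ n, ‖qp q n‖ ≤ A := fun n => hA _ ⟨n, rfl⟩
  have hB' : ∀ n, ‖(qp q n)⁻¹‖ ≤ B := fun n => hB _ ⟨n, rfl⟩
  have hA0 : 0 ≤ A := (norm_nonneg _).trans (hA' 0)
  have hB0 : 0 ≤ B := (norm_nonneg _).trans (hB' 0)
  refine ⟨A * B * B, by positivity, fun n k => ?_⟩
  rcases lt_or_ge n k with h | h
  · rw [gb_eq_zero q n k h, norm_zero]; positivity
  · obtain ⟨b, rfl⟩ := Nat.exists_eq_add_of_le h
    have h1 := qp_mul_gb q k b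
    have h2 : gb q (k + b) k = qp q (k + b) * (qp q k)⁻¹ * (qp q b)⁻¹ := by
      rw [← h1]
      have := hne k
      have := hne b
      field_simp
    rw [h2, norm_mul, norm_mul]
    gcongr
    · exact hA' _
    · exact hB' _
    · exact hB' _

lemma gb_limit {q L : ℂ} (hL : L ≠ 0) (hlim : Filter.Tendsto (qp q) Filter.atTop (nhds L))
    (hne : ∀ n, qp q n ≠ 0) (j : ℤ) :
    Filter.Tendsto (fun n : ℕ => gb q (2 * n) (j + n).toNat) Filter.atTop (nhds L⁻¹) := by
  have t : ∀ j : ℤ, Filter.Tendsto (fun n : ℕ => (j + n).toNat) Filter.atTop Filter.atTop := by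
    intro j
    refine Filter.tendsto_atTop.2 fun b => ?_
    filter_upwards [Filter.eventually_ge_atTop (b + j.natAbs)] with n hn
    omega
  have t2 : Filter.Tendsto (fun n : ℕ => 2 * n) Filter.atTop Filter.atTop :=
    Filter.tendsto_atTop_mono (fun n => by simp only [id]; omega) Filter.tendsto_id
  have h := ((hlim.comp t2).mul ((hlim.comp (t j)).inv₀ hL)).mul ((hlim.comp (t (-j))).inv₀ hL)
  rw [show L * L⁻¹ * L⁻¹ = L⁻¹ by field_simp] at h
  refine h.congr' ?_
  filter_upwards [Filter.eventually_ge_atTop j.natAbs] with n hn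
  have h1 := qp_mul_gb q (j + n).toNat (-j + n).toNat
  rw [show (j + n).toNat + (-j + n).toNat = 2 * n by omega] at h1
  simp only [Function.comp]
  rw [← h1]
  have := hne (j + n).toNat
  have := hne (-j + n).toNat
  field_simp

lemma triple_product (z τ : ℂ) (hτ : 0 < τ.im) :
    (1 - exp (-(2 * cπ * I * z))) *
    ∏' n : ℕ, ((1 - exp (2 * cπ * I * τ) ^ (n + 1) * exp (2 * cπ * I * z)) *
      (1 - exp (2 * cπ * I * τ) ^ (n + 1) * exp (-(2 * cπ * I * z))) *
      (1 - exp (2 * cπ * I * τ) ^ (n + 1))) = jacobiTheta₂ (z + τ / 2 + 1 / 2) τ := by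
  set r : ℂ := exp (cπ * I * τ) with hr
  set w : ℂ := exp (2 * cπ * I * z) with hw
  have hr0 : r ≠ 0 := exp_ne_zero _
  have hw0 : w ≠ 0 := exp_ne_zero _
  have hqr : exp (2 * cπ * I * τ) = r ^ 2 := by
    rw [hr, ← exp_nat_mul]; congr 1; push_cast; ring
  have hwi : exp (-(2 * cπ * I * z)) = w⁻¹ := by rw [hw, exp_neg]
  rw [hqr, hwi]
  have hq : ‖r ^ 2‖ < 1 := by
    rw [← hqr, norm_exp, Real.exp_lt_one_iff, cπ]
    have : (2 * (Real.pi : ℂ) * I * τ).re = - (2 * Real.pi * τ.im) := by simp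
    rw [this]
    have := Real.pi_pos
    have : 0 < 2 * Real.pi * τ.im := by positivity
    linarith
  obtain ⟨L, hL, hlim, hne⟩ := qp_limit hq
  obtain ⟨M, hM0, hM⟩ := gb_bound hq
  -- the terms
  have hterm : ∀ j : ℤ, (-1) ^ j * r ^ (j * (j + 1)) * w ^ j =
      jacobiTheta₂_term j (z + τ / 2 + 1 / 2) τ := by
    intro j
    rw [jacobiTheta₂_term, hr, hw, ← exp_pi_mul_I, ← exp_int_mul, ← exp_int_mul, ← exp_int_mul,
      ← exp_add, ← exp_add, cπ]
    congr 1
    push_cast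
    ring
  have hsum : Summable (fun j => ‖jacobiTheta₂_term j (z + τ / 2 + 1 / 2) τ‖) :=
    ((summable_jacobiTheta₂_term_iff _ τ).2 hτ).norm
  -- limit of the finite identity
  have hfin : ∀ n : ℕ,
      ∏ k ∈ Finset.range n, ((1 - (r ^ 2) ^ (k + 1) * w) * (1 - (r ^ 2) ^ k * w⁻¹)) =
      ∑' j : ℤ, (if j ∈ Finset.Icc (-(n : ℤ)) n then gb (r ^ 2) (2 * n) (j + n).toNat *
        jacobiTheta₂_term j (z + τ / 2 + 1 / 2) τ else 0) := by
    intro n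
    rw [finite_triple hr0 hw0, tsum_eq_sum (s := Finset.Icc (-(n : ℤ)) n)
      (fun j hj => by rw [if_neg hj])]
    refine Finset.sum_nbij' (fun i => (i : ℤ) - n) (fun j => (j + n).toNat) ?_ ?_ ?_ ?_ ?_
    · intro i hi
      have := Finset.mem_range.1 hi
      exact Finset.mem_Icc.2 (by omega)
    · intro j hj
      have := Finset.mem_Icc.1 hj
      exact Finset.mem_range.2 (by omega)
    · intro i hi
      simp
    · intro j hj
      have := Finset.mem_Icc.1 hj
      omega
    · intro i hi
      have h1 := Finset.mem_range.1 hi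
      rw [if_pos (Finset.mem_Icc.2 (by omega)), hterm]
      congr 2
      omega
  have hlim1 : Filter.Tendsto (fun n : ℕ => ∏ k ∈ Finset.range n,
      ((1 - (r ^ 2) ^ (k + 1) * w) * (1 - (r ^ 2) ^ k * w⁻¹))) Filter.atTop
      (nhds (∑' j : ℤ, L⁻¹ * jacobiTheta₂_term j (z + τ / 2 + 1 / 2) τ)) := by
    simp only [hfin]
    refine tendsto_tsum_of_dominated_convergence (hsum.mul_left M) ?_ ?_
    · intro j
      refine ((gb_limit hL hlim hne j).mul_const _).congr' ?_
      filter_upwards [Filter.eventually_ge_atTop j.natAbs] with n hn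
      rw [if_pos (Finset.mem_Icc.2 (by omega))]
    · refine Filter.Eventually.of_forall fun n j => ?_
      split_ifs
      · rw [norm_mul]
        gcongr
        exact hM _ _
      · rw [norm_zero]; positivity
  rw [tsum_mul_left, ← jacobiTheta₂] at hlim1
  have hgeo : Summable (fun n : ℕ => ‖r ^ 2‖ ^ (n + 1)) :=
    (summable_nat_add_iff 1).mpr (summable_geometric_of_lt_one (norm_nonneg _) hq)
  have hmul : ∀ x : ℂ, Multipliable (fun n : ℕ => 1 - (r ^ 2) ^ (n + 1) * x) := by
    intro x
    simp only [sub_eq_add_neg]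
    refine multipliable_one_add_of_summable ?_
    simpa [norm_mul, norm_pow] using hgeo.mul_right ‖x‖
  have hmul3 := ((hmul w).mul (hmul w⁻¹)).mul (hmul 1)
  simp only [mul_one] at hmul3
  have hlim2 := hmul3.hasProd.tendsto_prod_nat.const_mul (1 - w⁻¹)
  have hq0 : Filter.Tendsto (fun n : ℕ => 1 - (r ^ 2) ^ n * w⁻¹) Filter.atTop (nhds 1) := by
    simpa using ((tendsto_pow_atTop_nhds_zero_of_norm_lt_one hq).mul_const w⁻¹).const_sub 1
  have hlim3 := (hlim1.mul hq0).mul hlim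
  have e : L⁻¹ * jacobiTheta₂ (z + τ / 2 + 1 / 2) τ * 1 * L =
      jacobiTheta₂ (z + τ / 2 + 1 / 2) τ := by field_simp
  rw [e] at hlim3
  refine tendsto_nhds_unique hlim2 (hlim3.congr fun n => ?_)
  rw [qp, Finset.prod_mul_distrib, Finset.prod_mul_distrib, Finset.prod_mul_distrib]
  have h1 := Finset.prod_range_succ (fun k => 1 - (r ^ 2) ^ k * w⁻¹) n
  rw [Finset.prod_range_succ'] at h1
  simp only [pow_zero, one_mul] at h1
  linear_combination (-(∏ k ∈ Finset.range n, (1 - (r ^ 2) ^ (k + 1) * w)) *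
    ∏ k ∈ Finset.range n, (1 - (r ^ 2) ^ (k + 1))) * h1

lemma heat_JTheta1 : Heat (4 * cπ * I) JTheta1 := by
  have h := (heat_G (k := 1 / 2) (by norm_num) (1 / 2)).affine (-1) 2 1
  have hC : (2 : ℂ) ^ 2 * (2 * Real.pi * I * ((1 / 2 : ℝ) : ℂ)) = 4 * cπ * I := by
    rw [cπ]; push_cast; ring
  rw [hC] at h
  -- the closed form holds on the upper half-plane only
  have key : ∀ z τ : ℂ, 0 < τ.im → JTheta1 z τ =
      -1 * (exp (2 * Real.pi * I * ((1 / 2 : ℝ) : ℂ) * (1 / 2) ^ 2 * τ +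
        2 * Real.pi * I * ((1 / 2 : ℝ) : ℂ) * (1 / 2) * (2 * z + 1)) *
        jacobiTheta₂ (((1 / 2 : ℝ) : ℂ) * (2 * z + 1) + 2 * ((1 / 2 : ℝ) : ℂ) * (1 / 2) * τ)
          (2 * ((1 / 2 : ℝ) : ℂ) * τ)) := by
    intro z τ hτ
    have e1 : ((1 / 2 : ℝ) : ℂ) * (2 * z + 1) + 2 * ((1 / 2 : ℝ) : ℂ) * (1 / 2) * τ =
        z + τ / 2 + 1 / 2 := by push_cast; ring
    have e2 : 2 * ((1 / 2 : ℝ) : ℂ) * τ = τ := by push_cast; ring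
    have e3 : 2 * Real.pi * I * ((1 / 2 : ℝ) : ℂ) * (1 / 2) ^ 2 * τ +
        2 * Real.pi * I * ((1 / 2 : ℝ) : ℂ) * (1 / 2) * (2 * z + 1) =
        cπ * I * τ / 4 + cπ * z * I + Real.pi / 2 * I := by rw [cπ]; push_cast; ring
    rw [e1, e2, e3, exp_add, exp_add, exp_pi_div_two_mul_I, ← triple_product z τ hτ, JTheta1]
    have e4 : exp (-(2 * cπ * I * z)) = exp (-(cπ * z) * I) ^ 2 := by
      rw [← exp_nat_mul]; congr 1; push_cast; ring
    have e5 : exp (cπ * z * I) * exp (-(cπ * z) * I) = 1 := by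
      rw [← exp_add]; simp
    have e6 : 2 * sin (cπ * z) = -I * exp (cπ * z * I) * (1 - exp (-(2 * cπ * I * z))) := by
      rw [e4, sin]
      linear_combination (-I * exp (-(cπ * z) * I)) * e5
    generalize (∏' n : ℕ, ((1 - exp (2 * cπ * I * τ) ^ (n + 1) * exp (2 * cπ * I * z)) *
      (1 - exp (2 * cπ * I * τ) ^ (n + 1) * exp (-(2 * cπ * I * z))) *
      (1 - exp (2 * cπ * I * τ) ^ (n + 1)))) = P
    linear_combination (exp (cπ * I * τ / 4) * P) * e6
  have hfun : ∀ τ : ℂ, 0 < τ.im → (fun w => JTheta1 w τ) = _ :=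
    fun τ hτ => funext fun w => key w τ hτ
  have hopen : IsOpen {τ : ℂ | 0 < τ.im} := isOpen_lt continuous_const continuous_im
  have hev : ∀ z τ : ℂ, 0 < τ.im → (fun t => JTheta1 z t) =ᶠ[nhds τ] _ := fun z τ hτ =>
    Filter.eventuallyEq_of_mem (hopen.mem_nhds hτ)
      (fun t ht => key z t ht)
  refine ⟨fun z τ hτ => (h.dt z τ hτ).congr_of_eventuallyEq (hev z τ hτ), fun τ hτ => ?_,
    fun z τ hτ => ?_⟩
  · rw [hfun τ hτ]; exact h.dz τ hτ
  · rw [hfun τ hτ, (hev z τ hτ).deriv_eq]; exact h.heat z τ hτ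

lemma final_algebra (p κ : ℕ) (T S A B D Tt Tz : ℂ) (hT : T ≠ 0) (hpi : cπ ≠ 0)
    (hp : (p : ℂ) + 1 ≠ 0) (hpow : (p : ℂ) * T ^ (p - 1) * T = p * T ^ p) :
    (2 * cπ * I * κ * (((p + 1 : ℕ) : ℂ) * T ^ p * Tt * S + T ^ (p + 1) * (A + B)) =
      ((((p + 1 : ℕ) : ℂ) * ((p : ℂ) * T ^ (p - 1) * Tz) * Tz +
        ((p + 1 : ℕ) : ℂ) * T ^ p * (4 * cπ * I * Tt)) * S +
        ((p + 1 : ℕ) : ℂ) * T ^ p * Tz * D +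
        (((p + 1 : ℕ) : ℂ) * T ^ p * Tz * D +
          T ^ (p + 1) * (2 * cπ * I * (κ - 2 * p - 2) * B))) +
      p * (p + 1) * ((4 * cπ * I * Tt * T - Tz * Tz) / T ^ 2) * (T ^ (p + 1) * S)) ↔
    (κ / ((p : ℂ) + 1) * A = (2 * p + 2 - κ) * (Tt / T) * S - 2 * B +
      1 / (cπ * I) * (Tz / T) * D) := by
  have hI := I_ne_zero
  have hX : T ^ p ≠ 0 := pow_ne_zero _ hT
  have h1 : (p : ℂ) * T ^ (p - 1) = p * T ^ p / T := by
    rw [← hpow]; field_simp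
  rw [h1, pow_succ]
  push_cast
  generalize T ^ p = X at *
  clear hpow h1
  rw [← sub_eq_zero, ← sub_eq_zero (a := κ / ((p : ℂ) + 1) * A)]
  have key : ∀ U V k : ℂ, k ≠ 0 → U = k * V → (U = 0 ↔ V = 0) := by
    intro U V k hk h
    rw [h]; simp [hk]
  refine key _ _ (2 * cπ * I * (p + 1) * X * T) (by
    simp only [ne_eq, mul_eq_zero, not_or]; exact ⟨⟨⟨⟨⟨two_ne_zero, hpi⟩, hI⟩, hp⟩, hX⟩, hT⟩) ?_
  field_simp
  ring

/-- Let `p ≥ 0`, `κ ≥ 2p+3`, `m = κ-2p-2 ≥ 1`, and let `c_0,…,c_m` be holomorphic on `ℍ`.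
Then `v(λ,τ) = ϑ₁(λ,τ)^{p+1} Σ_{j=0}^m c_j(τ) θ^s_{m,j}(λ,τ)` satisfies the KZB heat
equation with parameters `κ`, `p` at all points of `ℂ×ℍ` with `ϑ₁(λ,τ) ≠ 0` if and only if
there `(κ/(p+1)) Σ_j c_j'(τ) θ^s_{m,j} = (2p+2-κ)(∂_τϑ₁/ϑ₁) Σ_j c_j θ^s_{m,j}
- 2 Σ_j c_j ∂_τθ^s_{m,j} + (1/(πi))(∂_λϑ₁/ϑ₁) Σ_j c_j ∂_λθ^s_{m,j}`. -/
theorem KZB_iff_coeff_ode (p κ m : ℕ) (hκ : 2 * p + 3 ≤ κ) (hm : m = κ - 2 * p - 2)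
    (c : ℕ → ℂ → ℂ)
    (hc : ∀ j ≤ m, DifferentiableOn ℂ (c j) {τ : ℂ | 0 < τ.im}) :
    (∀ z τ : ℂ, 0 < τ.im → JTheta1 z τ ≠ 0 →
      KZB κ p (fun w t =>
        JTheta1 w t ^ (p + 1) * ∑ j ∈ Finset.range (m + 1), c j t * ThetaS m (j : ℤ) w t) z τ)
    ↔
    (∀ z τ : ℂ, 0 < τ.im → JTheta1 z τ ≠ 0 →
      ((κ : ℂ) / ((p : ℂ) + 1)) *
          ∑ j ∈ Finset.range (m + 1), deriv (c j) τ * ThetaS m (j : ℤ) z τ =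
        (2 * (p : ℂ) + 2 - (κ : ℂ)) *
            (deriv (fun t => JTheta1 z t) τ / JTheta1 z τ) *
            (∑ j ∈ Finset.range (m + 1), c j τ * ThetaS m (j : ℤ) z τ)
          - 2 * ∑ j ∈ Finset.range (m + 1), c j τ * deriv (fun t => ThetaS m (j : ℤ) z t) τ
          + (1 / (cπ * I)) * (deriv (fun w => JTheta1 w τ) z / JTheta1 z τ) *
              ∑ j ∈ Finset.range (m + 1), c j τ * deriv (fun w => ThetaS m (j : ℤ) w τ) z) := by
  refine forall_congr' fun z => forall_congr' fun τ => forall_congr' fun hτ =>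
    forall_congr' fun hT => ?_
  have hm0 : 0 < m := by omega
  have hmC : (m : ℂ) = κ - 2 * p - 2 := by
    have : κ = m + 2 * p + 2 := by omega
    rw [this]; push_cast; ring
  have hpi : cπ ≠ 0 := by rw [cπ]; exact_mod_cast Real.pi_ne_zero
  have hp : (p : ℂ) + 1 ≠ 0 := by exact_mod_cast Nat.succ_ne_zero p
  have hθ := fun j : ℕ => heat_ThetaS hm0 (j : ℤ)
  have hopen : IsOpen {τ : ℂ | 0 < τ.im} := isOpen_lt continuous_const continuous_im
  have hcd : ∀ j ∈ Finset.range (m + 1), HasDerivAt (c j) (deriv (c j) τ) τ := fun j hj =>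
    ((hc j (by have := Finset.mem_range.1 hj; omega)).differentiableAt
      (hopen.mem_nhds hτ)).hasDerivAt
  -- derivatives of the theta sum
  have hSt : HasDerivAt (fun t => ∑ j ∈ Finset.range (m + 1), c j t * ThetaS m (j : ℤ) z t)
      (∑ j ∈ Finset.range (m + 1), (deriv (c j) τ * ThetaS m (j : ℤ) z τ +
        c j τ * deriv (fun t => ThetaS m (j : ℤ) z t) τ)) τ :=
    HasDerivAt.fun_sum fun j hj => (hcd j hj).mul ((hθ j).dt z τ hτ).hasDerivAt
  have hSz : ∀ w, HasDerivAt (fun w => ∑ j ∈ Finset.range (m + 1), c j τ * ThetaS m (j : ℤ) w τ)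
      (∑ j ∈ Finset.range (m + 1), c j τ * deriv (fun w => ThetaS m (j : ℤ) w τ) w) w := fun w =>
    HasDerivAt.fun_sum fun j hj => ((hθ j).dz τ hτ w).hasDerivAt.const_mul _
  have hSzz : HasDerivAt
      (fun w => ∑ j ∈ Finset.range (m + 1), c j τ * deriv (fun w => ThetaS m (j : ℤ) w τ) w)
      (∑ j ∈ Finset.range (m + 1), c j τ *
        (2 * cπ * I * m * deriv (fun t => ThetaS m (j : ℤ) z t) τ)) z :=
    HasDerivAt.fun_sum fun j hj => by
      rw [← (hθ j).heat z τ hτ]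
      exact (((hθ j).dz τ hτ).deriv z).hasDerivAt.const_mul _
  have hJ := heat_JTheta1
  have hTt := (hJ.dt z τ hτ).hasDerivAt
  have hTz : ∀ w, HasDerivAt (fun w => JTheta1 w τ) (deriv (fun w => JTheta1 w τ) w) w :=
    fun w => (hJ.dz τ hτ w).hasDerivAt
  have hTzz : HasDerivAt (deriv (fun w => JTheta1 w τ))
      (4 * cπ * I * deriv (fun t => JTheta1 z t) τ) z := by
    rw [← hJ.heat z τ hτ]
    exact ((hJ.dz τ hτ).deriv z).hasDerivAt
  have hρ : Rho' z τ = _ := (hTzz.fun_div (hTz z) hT).deriv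
  have hv1 := ((hTt.fun_pow (p + 1)).fun_mul hSt).deriv
  have hv2 : deriv (fun w => JTheta1 w τ ^ (p + 1) *
      ∑ j ∈ Finset.range (m + 1), c j τ * ThetaS m (j : ℤ) w τ) = _ :=
    funext fun w => (((hTz w).fun_pow (p + 1)).fun_mul (hSz w)).deriv
  have hv3 := (((((hTz z).fun_pow p).const_mul ((p + 1 : ℕ) : ℂ)).fun_mul hTzz).fun_mul
    (hSz z)).fun_add (((hTz z).fun_pow (p + 1)).fun_mul hSzz)
  simp only [Nat.add_sub_cancel] at hv1 hv2
  rw [KZB, iteratedDeriv_succ, iteratedDeriv_one, hv1, hv2, hv3.deriv, hρ]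
  simp only [mul_left_comm (c _ τ) (2 * cπ * I * m)]
  rw [← Finset.mul_sum, Finset.sum_add_distrib, hmC]
  clear hρ hv1 hv2 hv3 hSt hSz hSzz hTt hTzz
  have hpow : (p : ℂ) * JTheta1 z τ ^ (p - 1) * JTheta1 z τ = p * JTheta1 z τ ^ p := by
    cases p with
    | zero => simp
    | succ n => simp [pow_succ]; ring
  generalize (∑ j ∈ Finset.range (m + 1), c j τ * ThetaS m (j : ℤ) z τ) = S
  generalize (∑ j ∈ Finset.range (m + 1), deriv (c j) τ * ThetaS m (j : ℤ) z τ) = A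
  generalize (∑ j ∈ Finset.range (m + 1), c j τ * deriv (fun t => ThetaS m (j : ℤ) z t) τ) = B
  generalize (∑ j ∈ Finset.range (m + 1), c j τ * deriv (fun w => ThetaS m (j : ℤ) w τ) z) = D
  generalize deriv (fun t => JTheta1 z t) τ = Tt
  generalize deriv (fun w => JTheta1 w τ) z = Tz
  exact final_algebra p κ (JTheta1 z τ) S A B D Tt Tz hT hpi hp hpow
end
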